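/- arXiv:2309.09757 — 2 statements merged into one kernel-verified Lean document; each statement's English description precedes it below -/
import Mathlib

section
/- Let M ⊂ ℂⁿ be a smooth pseudoconvex real hypersurface, p ∈ M, and let L be a smooth CR vector field along M with L(p) ≠ 0. If either c_L(M,p) = 4 or t_L(M,p) = 4, then c_L(M,p) = t_L(M,p) = 4. -/
open Topology

/-- ℂⁿ as a Pi type. -/
abbrev Cn (n : ℕ) := Fin n → ℂ

/-- The Wirtinger derivative `∂f/∂z_j` of a (real-)smooth function `f : ℂⁿ → ℂ`. -/
noncomputable def wz {n : ℕ} (j : Fin n) (f : Cn n → ℂ) (x : Cn n) : ℂ :=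
  (fderiv ℝ f x (Pi.single j 1) - Complex.I * fderiv ℝ f x (Pi.single j Complex.I)) / 2

/-- The Wirtinger derivative `∂f/∂z̄_j` of a (real-)smooth function `f : ℂⁿ → ℂ`. -/
noncomputable def wzb {n : ℕ} (j : Fin n) (f : Cn n → ℂ) (x : Cn n) : ℂ :=
  (fderiv ℝ f x (Pi.single j 1) + Complex.I * fderiv ℝ f x (Pi.single j Complex.I)) / 2

/-- The complexification of a real-valued function on ℂⁿ. -/
def cx {n : ℕ} (ρ : Cn n → ℝ) : Cn n → ℂ := fun x => (ρ x : ℂ)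

/-- A complex vector field of mixed type `(1,0) + (0,1)` on ℂⁿ:
`W = Σ_j hol_j ∂/∂z_j + Σ_j anti_j ∂/∂z̄_j`. -/
structure CVF (n : ℕ) where
  hol : Fin n → Cn n → ℂ
  anti : Fin n → Cn n → ℂ

/-- Action of a mixed-type complex vector field on functions, as a derivation. -/
noncomputable def CVF.act {n : ℕ} (W : CVF n) (f : Cn n → ℂ) : Cn n → ℂ :=
  fun x => (∑ j, W.hol j x * wz j f x) + (∑ j, W.anti j x * wzb j f x)

/-- Lie bracket of two mixed-type complex vector fields (with smooth coefficients the
commutator `[V,W]` of the first–order operators is again first order with these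
coefficients). -/
noncomputable def CVF.bracket {n : ℕ} (V W : CVF n) : CVF n where
  hol := fun j x => V.act (W.hol j) x - W.act (V.hol j) x
  anti := fun j x => V.act (W.anti j) x - W.act (V.anti j) x

/-- The `(1,0)` vector field `L = Σ_j a_j ∂/∂z_j`. -/
def LVF {n : ℕ} (a : Fin n → Cn n → ℂ) : CVF n := ⟨a, fun _ _ => 0⟩

/-- The conjugate `(0,1)` vector field `L̄ = Σ_j ā_j ∂/∂z̄_j`. -/
def LbarVF {n : ℕ} (a : Fin n → Cn n → ℂ) : CVF n :=
  ⟨fun _ _ => 0, fun j x => starRingEnd ℂ (a j x)⟩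

/-- `a` is a smooth CR vector field along `M = {ρ = 0}`: smooth coefficients annihilating
`ρ` in the `(1,0)` directions, i.e. `Σ_j a_j ∂ρ/∂z_j = 0` on `M`. -/
def IsCRField {n : ℕ} (ρ : Cn n → ℝ) (M : Set (Cn n)) (a : Fin n → Cn n → ℂ) : Prop :=
  (∀ j, ContDiff ℝ (⊤ : ℕ∞) (a j)) ∧ ∀ x ∈ M, ∑ j, a j x * wz j (cx ρ) x = 0

/-- Membership in the module `𝓜₁(L)` generated over smooth functions by `L` and `L̄`. -/
def InM1 {n : ℕ} (a : Fin n → Cn n → ℂ) (W : CVF n) : Prop :=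
  ∃ c₁ c₂ : Cn n → ℂ, ContDiff ℝ (⊤ : ℕ∞) c₁ ∧ ContDiff ℝ (⊤ : ℕ∞) c₂ ∧
    (∀ j x, W.hol j x = c₁ x * a j x) ∧ (∀ j x, W.anti j x = c₂ x * starRingEnd ℂ (a j x))

/-- `ν_L(f)(p)`: the smallest `m` such that `Y_m(⋯(Y_1 f)⋯)(p) ≠ 0` for some
`Y₁, …, Y_m ∈ 𝓜₁(L)`; `⊤` if no such `m` exists. -/
noncomputable def nuL {n : ℕ} (a : Fin n → Cn n → ℂ) (f : Cn n → ℂ) (p : Cn n) : ℕ∞ :=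
  sInf {m : ℕ∞ | ∃ Ws : List (CVF n), (Ws.length : ℕ∞) = m ∧ (∀ W ∈ Ws, InM1 a W) ∧
    (Ws.foldl (fun g W => W.act g) f) p ≠ 0}

/-- The coefficient `∂²ρ/∂z_j ∂z̄_l` of the Levi form. -/
noncomputable def leviCoeff {n : ℕ} (ρ : Cn n → ℝ) (j l : Fin n) (x : Cn n) : ℂ :=
  wz j (wzb l (cx ρ)) x

/-- The Levi form `λ(X,Y) = Σ_{j,l} (∂²ρ/∂z_j∂z̄_l) ξ_j η̄_l` of the fields with
coefficients `ξ`, `η`, as a function on ℂⁿ. -/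
noncomputable def levi {n : ℕ} (ρ : Cn n → ℝ) (ξ η : Fin n → Cn n → ℂ) (x : Cn n) : ℂ :=
  ∑ j, ∑ l, leviCoeff ρ j l x * ξ j x * starRingEnd ℂ (η l x)

/-- `M = {ρ = 0}` is pseudoconvex: the Levi form is positive semi-definite on the
CR directions at every point of `M`. -/
def Pseudoconvex {n : ℕ} (ρ : Cn n → ℝ) (M : Set (Cn n)) : Prop :=
  ∀ x ∈ M, ∀ ξ : Fin n → ℂ, (∑ j, ξ j * wz j (cx ρ) x) = 0 →
    0 ≤ (∑ j, ∑ l, leviCoeff ρ j l x * ξ j * starRingEnd ℂ (ξ l)).re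

/-- Iterated commutators of length `μ` of elements of `𝓜₁(L)`:
`[Y_μ, [Y_{μ-1}, ⋯ [Y₂, Y₁]⋯]]` with each `Y_i ∈ 𝓜₁(L)`. -/
inductive IsCommOf {n : ℕ} (a : Fin n → Cn n → ℂ) : ℕ → CVF n → Prop
  | one (W : CVF n) : InM1 a W → IsCommOf a 1 W
  | succ {μ : ℕ} (V W : CVF n) : InM1 a V → IsCommOf a μ W → IsCommOf a (μ + 1) (V.bracket W)

/-- The pairing `⟨∂ρ, G⟩(p)` of a mixed-type field with the `(1,0)` form `∂ρ`. -/
noncomputable def pairDRho {n : ℕ} (ρ : Cn n → ℝ) (G : CVF n) (p : Cn n) : ℂ :=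
  ∑ j, G.hol j p * wz j (cx ρ) p

/-- The commutator type `t_L(M,p)`: the smallest `m` such that `⟨∂ρ, G⟩(p) ≠ 0` for some
iterated commutator `G` of length (at most) `m` of elements of `𝓜₁(L)`; `⊤` if none. -/
noncomputable def tType {n : ℕ} (ρ : Cn n → ℝ) (a : Fin n → Cn n → ℂ) (p : Cn n) : ℕ∞ :=
  sInf {m : ℕ∞ | ∃ μ : ℕ, (μ : ℕ∞) = m ∧ ∃ G : CVF n, IsCommOf a μ G ∧ pairDRho ρ G p ≠ 0}

/-- The Levi-form type `c_L(M,p) = 2 + ν_L(λ(L,L))(p)`. -/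
noncomputable def cType {n : ℕ} (ρ : Cn n → ℝ) (a : Fin n → Cn n → ℂ) (p : Cn n) : ℕ∞ :=
  2 + nuL a (levi ρ a a) p

/-- Second-order necessary condition for a local minimum. -/
theorem deriv_deriv_nonneg_of_isLocalMin {k : ℝ → ℝ} {t : ℝ} (hk : IsLocalMin k t)
    (hc : ContinuousAt k t) : 0 ≤ deriv (deriv k) t := by
  by_contra! hneg
  have hmax := isLocalMax_of_deriv_deriv_neg hneg hk.deriv_eq_zero hc
  have hconst : k =ᶠ[𝓝 t] fun _ => k t := by
    filter_upwards [hk, hmax] with s h₁ h₂ using le_antisymm h₂ h₁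
  have := hconst.deriv.deriv_eq
  simp at this
  exact absurd hneg (by rw [this]; simp)

section ZeroLocus

variable {E : Type*} [NormedAddCommGroup E] [NormedSpace ℝ E] [CompleteSpace E]
  {ρ : E → ℝ} {p : E}

/-- Through a point of `{ρ = 0}` passes an integral curve, staying inside `{ρ = 0}`, of the
projection of `X` along `v` to the kernel of `dρ`. -/
theorem exists_curve_in_zeroLocus (hρ : ContDiff ℝ (⊤ : ℕ∞) ρ)
    (hp : ρ p = 0) {X : E → E} (hX : ContDiff ℝ (⊤ : ℕ∞) X) (v : E) :
    ∃ γ : ℝ → E, γ 0 = p ∧ (∀ᶠ t in 𝓝 (0 : ℝ), ρ (γ t) = 0) ∧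
      ∀ᶠ t in 𝓝 (0 : ℝ), HasDerivAt γ
        (fderiv ℝ ρ (γ t) v • X (γ t) - fderiv ℝ ρ (γ t) (X (γ t)) • v) t := by
  have hdρ : ContDiff ℝ (⊤ : ℕ∞) (fderiv ℝ ρ) := hρ.fderiv_right (by simp)
  have hY : ContDiff ℝ (⊤ : ℕ∞) fun x => fderiv ℝ ρ x v • X x - fderiv ℝ ρ x (X x) • v := by
    fun_prop
  obtain ⟨γ, h0, ε, hε, hγ⟩ := (hY.contDiffAt (x := p)).of_le (m := 1) (by simp)
    |>.exists_forall_mem_closedBall_exists_eq_forall_mem_Ioo_hasDerivAt₀ 0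
  have hI : Set.Ioo (0 - ε) (0 + ε) ∈ 𝓝 (0 : ℝ) := Ioo_mem_nhds (by linarith) (by linarith)
  refine ⟨γ, h0, ?_, Filter.mem_of_superset hI hγ⟩
  have hder : ∀ t ∈ Set.Ioo (0 - ε) (0 + ε), HasDerivAt (ρ ∘ γ) 0 t := fun t ht => by
    have := ((hρ.differentiable (by simp)) (γ t)).hasFDerivAt.comp_hasDerivAt t (hγ t ht)
    simpa [mul_comm] using this
  filter_upwards [hI] with t ht
  have := isOpen_Ioo.is_const_of_deriv_eq_zero (convex_Ioo _ _).isPreconnected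
    (fun s hs => (hder s hs).differentiableAt.differentiableWithinAt)
    (fun s hs => (hder s hs).deriv) ht (mem_of_mem_nhds hI)
  simpa [h0, hp] using this

theorem fderiv_eq_zero_of_nonneg_on_zeroLocus (hρ : ContDiff ℝ (⊤ : ℕ∞) ρ) (hp : ρ p = 0)
    (hdp : fderiv ℝ ρ p ≠ 0) {h : E → ℝ} (hh : ContDiff ℝ (⊤ : ℕ∞) h)
    (hnonneg : ∀ x, ρ x = 0 → 0 ≤ h x) (hhp : h p = 0) {w : E} (hw : fderiv ℝ ρ p w = 0) :
    fderiv ℝ h p w = 0 := by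
  obtain ⟨v, hv⟩ : ∃ v, fderiv ℝ ρ p v ≠ 0 := by
    by_contra! H; exact hdp (ContinuousLinearMap.ext H)
  obtain ⟨γ, h0, hmem, hγ⟩ := exists_curve_in_zeroLocus hρ hp (X := fun _ => w) contDiff_const v
  have hmin : IsLocalMin (h ∘ γ) 0 := by
    filter_upwards [hmem] with t ht
    simpa [h0, hhp] using hnonneg _ ht
  have := ((hh.differentiable (by simp)) (γ 0)).hasFDerivAt.comp_hasDerivAt 0 hγ.self_of_nhds
  have := this.deriv.symm.trans hmin.deriv_eq_zero
  simpa [h0, hw, hv] using this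

theorem fderiv_eq_zero_of_eq_zero_on_zeroLocus (hρ : ContDiff ℝ (⊤ : ℕ∞) ρ) (hp : ρ p = 0)
    (hdp : fderiv ℝ ρ p ≠ 0) {h : E → ℝ} (hh : ContDiff ℝ (⊤ : ℕ∞) h)
    (hzero : ∀ x, ρ x = 0 → h x = 0) {w : E} (hw : fderiv ℝ ρ p w = 0) :
    fderiv ℝ h p w = 0 :=
  fderiv_eq_zero_of_nonneg_on_zeroLocus hρ hp hdp hh (fun x hx => (hzero x hx).ge)
    (hzero p hp) hw

/-- If `h ≥ 0` on `{ρ = 0}` vanishes at `p`, then `X (X h) ≥ 0` at `p` for every field `X`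
tangent to `{ρ = 0}`. -/
theorem fderiv_fderiv_nonneg_on_zeroLocus (hρ : ContDiff ℝ (⊤ : ℕ∞) ρ) (hp : ρ p = 0)
    (hdp : fderiv ℝ ρ p ≠ 0) {h : E → ℝ} (hh : ContDiff ℝ (⊤ : ℕ∞) h)
    (hnonneg : ∀ x, ρ x = 0 → 0 ≤ h x) (hhp : h p = 0) {X : E → E}
    (hX : ContDiff ℝ (⊤ : ℕ∞) X) (htan : ∀ x, ρ x = 0 → fderiv ℝ ρ x (X x) = 0) :
    0 ≤ fderiv ℝ (fun x => fderiv ℝ h x (X x)) p (X p) := by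
  obtain ⟨v, hv⟩ : ∃ v, fderiv ℝ ρ p v ≠ 0 := by
    by_contra! H; exact hdp (ContinuousLinearMap.ext H)
  obtain ⟨γ, h0, hmem, hγ⟩ := exists_curve_in_zeroLocus hρ hp hX v
  have hmin : IsLocalMin (h ∘ γ) 0 := by
    filter_upwards [hmem] with t ht
    simpa [h0, hhp] using hnonneg _ ht
  have hdρ : ContDiff ℝ (⊤ : ℕ∞) (fderiv ℝ ρ) := hρ.fderiv_right (by simp)
  have hdh : ContDiff ℝ (⊤ : ℕ∞) (fderiv ℝ h) := hh.fderiv_right (by simp)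
  set A : E → ℝ := fun x => fderiv ℝ ρ x v with hA
  set B : E → ℝ := fun x => fderiv ℝ ρ x (X x) with hB
  set C : E → ℝ := fun x => fderiv ℝ h x (X x) with hC
  set D : E → ℝ := fun x => fderiv ℝ h x v with hD
  have hAd : ContDiff ℝ (⊤ : ℕ∞) A := by fun_prop
  have hBd : ContDiff ℝ (⊤ : ℕ∞) B := by fun_prop
  have hCd : ContDiff ℝ (⊤ : ℕ∞) C := by fun_prop
  have hDd : ContDiff ℝ (⊤ : ℕ∞) D := by fun_prop
  have hderiv : deriv (h ∘ γ) =ᶠ[𝓝 0] (fun x => A x * C x - B x * D x) ∘ γ := by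
    filter_upwards [hγ] with t ht
    have := ((hh.differentiable (by simp)) (γ t)).hasFDerivAt.comp_hasDerivAt t ht
    rw [this.deriv]; simp [A, B, C, D]
  have hsecond := deriv_deriv_nonneg_of_isLocalMin hmin
    ((hh.continuous.continuousAt).comp hγ.self_of_nhds.continuousAt)
  have hd : ∀ {f : E → ℝ}, ContDiff ℝ (⊤ : ℕ∞) f → HasFDerivAt f (fderiv ℝ f p) p := fun hf =>
    ((hf.differentiable (by simp)) p).hasFDerivAt
  have hF := ((hd hAd).mul (hd hCd)).sub ((hd hBd).mul (hd hDd))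
  have hcomp := HasFDerivAt.comp_hasDerivAt (0 : ℝ) (h0.symm ▸ hF) hγ.self_of_nhds
  have hBp : B p = 0 := htan p hp
  have hCp : C p = 0 := fderiv_eq_zero_of_nonneg_on_zeroLocus hρ hp hdp hh hnonneg hhp hBp
  have hdB : fderiv ℝ B p (X p) = 0 :=
    fderiv_eq_zero_of_eq_zero_on_zeroLocus hρ hp hdp hBd htan hBp
  have hval := hderiv.deriv_eq.trans hcomp.deriv
  rw [hval] at hsecond
  have hXp : fderiv ℝ ρ p (X p) = 0 := hBp
  simp only [h0, hXp, zero_smul, sub_zero, map_smul, sub_apply, add_apply,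
    smul_apply, hdB, hBp, hCp, smul_eq_mul, mul_zero, add_zero, zero_apply] at hsecond
  have hv2 : 0 < fderiv ℝ ρ p v * fderiv ℝ ρ p v := mul_self_pos.mpr hv
  have hAp : A p = fderiv ℝ ρ p v := rfl
  rw [hAp, ← mul_assoc] at hsecond
  exact nonneg_of_mul_nonneg_right hsecond hv2

end ZeroLocus

section Wirtinger

open ComplexConjugate

variable {n : ℕ}

theorem ContDiff.wz {f : Cn n → ℂ} (hf : ContDiff ℝ (⊤ : ℕ∞) f) (j : Fin n) :
    ContDiff ℝ (⊤ : ℕ∞) (wz j f) := by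
  have hdf : ContDiff ℝ (⊤ : ℕ∞) (fderiv ℝ f) := hf.fderiv_right (by simp)
  unfold _root_.wz
  fun_prop

theorem ContDiff.wzb {f : Cn n → ℂ} (hf : ContDiff ℝ (⊤ : ℕ∞) f) (j : Fin n) :
    ContDiff ℝ (⊤ : ℕ∞) (wzb j f) := by
  have hdf : ContDiff ℝ (⊤ : ℕ∞) (fderiv ℝ f) := hf.fderiv_right (by simp)
  unfold _root_.wzb
  fun_prop

theorem ContDiff.star_comp {f : Cn n → ℂ} (hf : ContDiff ℝ (⊤ : ℕ∞) f) :
    ContDiff ℝ (⊤ : ℕ∞) fun x => conj (f x) :=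
  Complex.conjCLE.contDiff.comp hf

theorem ContDiff.cx {ρ : Cn n → ℝ} (hρ : ContDiff ℝ (⊤ : ℕ∞) ρ) : ContDiff ℝ (⊤ : ℕ∞) (cx ρ) :=
  Complex.ofRealCLM.contDiff.comp hρ

theorem fderiv_wz {f : Cn n → ℂ} (hf : ContDiff ℝ (⊤ : ℕ∞) f) (j : Fin n) (x v : Cn n) :
    fderiv ℝ (wz j f) x v = (fderiv ℝ (fderiv ℝ f) x v (Pi.single j 1)
      - Complex.I * fderiv ℝ (fderiv ℝ f) x v (Pi.single j Complex.I)) / 2 := by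
  have hdf : ContDiff ℝ (⊤ : ℕ∞) (fderiv ℝ f) := hf.fderiv_right (by simp)
  have hd : HasFDerivAt (fderiv ℝ f) (fderiv ℝ (fderiv ℝ f) x) x :=
    ((hdf.differentiable (by simp)) x).hasFDerivAt
  have := ((hd.clm_apply (hasFDerivAt_const (Pi.single j 1 : Cn n) x)).sub
    ((hd.clm_apply (hasFDerivAt_const (Pi.single j Complex.I : Cn n) x)).const_mul
      Complex.I)).mul_const (2⁻¹ : ℂ)
  have h2 : HasFDerivAt (wz j f) _ x := this.congr_of_eventuallyEq
    (Filter.Eventually.of_forall fun y => by simp [wz, div_eq_mul_inv])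
  rw [h2.fderiv]
  simp [div_eq_mul_inv, mul_comm]

theorem fderiv_wzb {f : Cn n → ℂ} (hf : ContDiff ℝ (⊤ : ℕ∞) f) (j : Fin n) (x v : Cn n) :
    fderiv ℝ (wzb j f) x v = (fderiv ℝ (fderiv ℝ f) x v (Pi.single j 1)
      + Complex.I * fderiv ℝ (fderiv ℝ f) x v (Pi.single j Complex.I)) / 2 := by
  have hdf : ContDiff ℝ (⊤ : ℕ∞) (fderiv ℝ f) := hf.fderiv_right (by simp)
  have hd : HasFDerivAt (fderiv ℝ f) (fderiv ℝ (fderiv ℝ f) x) x :=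
    ((hdf.differentiable (by simp)) x).hasFDerivAt
  have := ((hd.clm_apply (hasFDerivAt_const (Pi.single j 1 : Cn n) x)).add
    ((hd.clm_apply (hasFDerivAt_const (Pi.single j Complex.I : Cn n) x)).const_mul
      Complex.I)).mul_const (2⁻¹ : ℂ)
  have h2 : HasFDerivAt (wzb j f) _ x := this.congr_of_eventuallyEq
    (Filter.Eventually.of_forall fun y => by simp [wzb, div_eq_mul_inv])
  rw [h2.fderiv]
  simp [div_eq_mul_inv, mul_comm, mul_add]

theorem fderiv_fderiv_comm {f : Cn n → ℂ} (hf : ContDiff ℝ (⊤ : ℕ∞) f) (x v w : Cn n) :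
    fderiv ℝ (fderiv ℝ f) x v w = fderiv ℝ (fderiv ℝ f) x w v :=
  (hf.contDiffAt.isSymmSndFDerivAt (by
    rw [minSmoothness_of_isRCLikeNormedField]; exact WithTop.coe_le_coe.mpr le_top)).eq v w

theorem wz_wz_comm {f : Cn n → ℂ} (hf : ContDiff ℝ (⊤ : ℕ∞) f) (j l : Fin n) (x : Cn n) :
    wz j (wz l f) x = wz l (wz j f) x := by
  rw [wz, wz, fderiv_wz hf, fderiv_wz hf, fderiv_wz hf, fderiv_wz hf,
    fderiv_fderiv_comm hf x (Pi.single l 1), fderiv_fderiv_comm hf x (Pi.single l 1),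
    fderiv_fderiv_comm hf x (Pi.single l Complex.I),
    fderiv_fderiv_comm hf x (Pi.single l Complex.I)]
  ring

theorem wz_wzb_comm {f : Cn n → ℂ} (hf : ContDiff ℝ (⊤ : ℕ∞) f) (j l : Fin n) (x : Cn n) :
    wz j (wzb l f) x = wzb l (wz j f) x := by
  rw [wz, wzb, fderiv_wz hf, fderiv_wz hf, fderiv_wzb hf, fderiv_wzb hf,
    fderiv_fderiv_comm hf x (Pi.single l 1), fderiv_fderiv_comm hf x (Pi.single l 1),
    fderiv_fderiv_comm hf x (Pi.single l Complex.I),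
    fderiv_fderiv_comm hf x (Pi.single l Complex.I)]
  ring

theorem wzb_wzb_comm {f : Cn n → ℂ} (hf : ContDiff ℝ (⊤ : ℕ∞) f) (j l : Fin n) (x : Cn n) :
    wzb j (wzb l f) x = wzb l (wzb j f) x := by
  rw [wzb, wzb, fderiv_wzb hf, fderiv_wzb hf, fderiv_wzb hf, fderiv_wzb hf,
    fderiv_fderiv_comm hf x (Pi.single l 1), fderiv_fderiv_comm hf x (Pi.single l 1),
    fderiv_fderiv_comm hf x (Pi.single l Complex.I),
    fderiv_fderiv_comm hf x (Pi.single l Complex.I)]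
  ring

theorem fderiv_star_comp {f : Cn n → ℂ} (hf : ContDiff ℝ (⊤ : ℕ∞) f) (x v : Cn n) :
    fderiv ℝ (fun y => conj (f y)) x v = conj (fderiv ℝ f x v) := by
  have := Complex.conjCLE.hasFDerivAt.comp x ((hf.differentiable (by simp)) x).hasFDerivAt
  rw [show (fun y => conj (f y)) = Complex.conjCLE ∘ f from rfl, this.fderiv]
  simp

theorem wz_star {f : Cn n → ℂ} (hf : ContDiff ℝ (⊤ : ℕ∞) f) (j : Fin n) (x : Cn n) :
    wz j (fun y => conj (f y)) x = conj (wzb j f x) := by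
  simp [wz, wzb, fderiv_star_comp hf, sub_eq_add_neg, Complex.conj_ofNat]

theorem wzb_star {f : Cn n → ℂ} (hf : ContDiff ℝ (⊤ : ℕ∞) f) (j : Fin n) (x : Cn n) :
    wzb j (fun y => conj (f y)) x = conj (wz j f x) := by
  simp [wz, wzb, fderiv_star_comp hf, Complex.conj_ofNat]

theorem wzb_cx {ρ : Cn n → ℝ} (hρ : ContDiff ℝ (⊤ : ℕ∞) ρ) (j : Fin n) (x : Cn n) :
    wzb j (cx ρ) x = conj (wz j (cx ρ) x) := by
  rw [← wzb_star hρ.cx]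
  congr 1
  simp [funext_iff, cx]

theorem fderiv_cx {ρ : Cn n → ℝ} (hρ : ContDiff ℝ (⊤ : ℕ∞) ρ) (x v : Cn n) :
    fderiv ℝ (cx ρ) x v = (fderiv ℝ ρ x v : ℂ) := by
  have := Complex.ofRealCLM.hasFDerivAt.comp x ((hρ.differentiable (by simp)) x).hasFDerivAt
  rw [show cx ρ = Complex.ofRealCLM ∘ ρ from rfl, this.fderiv]
  simp

theorem clm_apply_eq_sum (φ : Cn n →L[ℝ] ℂ) (w : Cn n) :
    φ w = ∑ j, ((w j).re * φ (Pi.single j 1) + (w j).im * φ (Pi.single j Complex.I)) := by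
  conv_lhs => rw [← Finset.univ_sum_single w, map_sum]
  refine Finset.sum_congr rfl fun j _ => ?_
  have : (Pi.single j (w j) : Cn n)
      = (w j).re • (Pi.single j 1 : Cn n) + (w j).im • (Pi.single j Complex.I : Cn n) := by
    rw [← Pi.single_smul, ← Pi.single_smul, ← Pi.single_add]
    congr 1
    simp [Complex.re_add_im]
  rw [this]
  simp

namespace CVF

/-- The real part of a complex vector field. -/
noncomputable def rePart (V : CVF n) (x : Cn n) : Cn n :=
  fun j => (V.hol j x + conj (V.anti j x)) / 2

/-- The imaginary part of a complex vector field. -/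
noncomputable def imPart (V : CVF n) (x : Cn n) : Cn n :=
  fun j => -Complex.I * (V.hol j x - conj (V.anti j x)) / 2

/-- The conjugate of a complex vector field. -/
noncomputable def bar (V : CVF n) : CVF n where
  hol := fun j x => conj (V.anti j x)
  anti := fun j x => conj (V.hol j x)

/-- A complex vector field with smooth coefficients. -/
def Smooth (V : CVF n) : Prop :=
  (∀ j, ContDiff ℝ (⊤ : ℕ∞) (V.hol j)) ∧ ∀ j, ContDiff ℝ (⊤ : ℕ∞) (V.anti j)

theorem act_eq_fderiv (V : CVF n) (f : Cn n → ℂ) (x : Cn n) :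
    V.act f x = fderiv ℝ f x (V.rePart x) + Complex.I * fderiv ℝ f x (V.imPart x) := by
  rw [clm_apply_eq_sum _ (V.rePart x), clm_apply_eq_sum _ (V.imPart x), Finset.mul_sum,
    act, ← Finset.sum_add_distrib, ← Finset.sum_add_distrib]
  refine Finset.sum_congr rfl fun j _ => ?_
  simp only [wz, wzb, rePart, imPart]
  generalize fderiv ℝ f x (Pi.single j 1) = P
  generalize fderiv ℝ f x (Pi.single j Complex.I) = Q
  generalize V.hol j x = u
  generalize V.anti j x = w
  apply Complex.ext <;> simp <;> ring

theorem act_add (V : CVF n) {f g : Cn n → ℂ} (hf : ContDiff ℝ (⊤ : ℕ∞) f)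
    (hg : ContDiff ℝ (⊤ : ℕ∞) g) (x : Cn n) :
    V.act (fun y => f y + g y) x = V.act f x + V.act g x := by
  simp only [act_eq_fderiv]
  rw [fderiv_fun_add (hf.differentiable (by simp) x) (hg.differentiable (by simp) x)]
  simp only [add_apply]
  ring

theorem act_neg (V : CVF n) (f : Cn n → ℂ) (x : Cn n) :
    V.act (fun y => -f y) x = -V.act f x := by
  simp only [act_eq_fderiv, fderiv_fun_neg, neg_apply]
  ring

theorem act_sub (V : CVF n) {f g : Cn n → ℂ} (hf : ContDiff ℝ (⊤ : ℕ∞) f)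
    (hg : ContDiff ℝ (⊤ : ℕ∞) g) (x : Cn n) :
    V.act (fun y => f y - g y) x = V.act f x - V.act g x := by
  simp only [sub_eq_add_neg]
  rw [V.act_add hf hg.neg, act_neg]

theorem act_mul (V : CVF n) {f g : Cn n → ℂ} (hf : ContDiff ℝ (⊤ : ℕ∞) f)
    (hg : ContDiff ℝ (⊤ : ℕ∞) g) (x : Cn n) :
    V.act (fun y => f y * g y) x = V.act f x * g x + f x * V.act g x := by
  simp only [act_eq_fderiv]
  rw [fderiv_fun_mul (hf.differentiable (by simp) x) (hg.differentiable (by simp) x)]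
  simp only [add_apply, smul_apply, smul_eq_mul]
  ring

theorem act_sum (V : CVF n) {ι : Type*} (s : Finset ι) {f : ι → Cn n → ℂ}
    (hf : ∀ i, ContDiff ℝ (⊤ : ℕ∞) (f i)) (x : Cn n) :
    V.act (fun y => ∑ i ∈ s, f i y) x = ∑ i ∈ s, V.act (f i) x := by
  simp only [act_eq_fderiv]
  rw [fderiv_fun_sum fun i _ => (hf i).differentiable (by simp) x]
  simp [Finset.sum_add_distrib, Finset.mul_sum]

theorem act_const (V : CVF n) (c : ℂ) (x : Cn n) : V.act (fun _ => c) x = 0 := by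
  simp [act_eq_fderiv]

theorem act_star (V : CVF n) {f : Cn n → ℂ} (hf : ContDiff ℝ (⊤ : ℕ∞) f) (x : Cn n) :
    V.act (fun y => conj (f y)) x = conj (V.bar.act f x) := by
  simp [act, bar, wz_star hf, wzb_star hf, add_comm]

theorem Smooth.act {V : CVF n} (hV : V.Smooth) {f : Cn n → ℂ} (hf : ContDiff ℝ (⊤ : ℕ∞) f) :
    ContDiff ℝ (⊤ : ℕ∞) (V.act f) :=
  (ContDiff.sum fun j _ => (hV.1 j).mul (hf.wz j)).add
    (ContDiff.sum fun j _ => (hV.2 j).mul (hf.wzb j))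

theorem Smooth.bracket {V W : CVF n} (hV : V.Smooth) (hW : W.Smooth) : (V.bracket W).Smooth :=
  ⟨fun j => (hV.act (hW.1 j)).sub (hW.act (hV.1 j)),
    fun j => (hV.act (hW.2 j)).sub (hW.act (hV.2 j))⟩

theorem Smooth.bar {V : CVF n} (hV : V.Smooth) : V.bar.Smooth :=
  ⟨fun j => (hV.2 j).star_comp, fun j => (hV.1 j).star_comp⟩

theorem act_act (V : CVF n) {W : CVF n} (hW : W.Smooth) {f : Cn n → ℂ}
    (hf : ContDiff ℝ (⊤ : ℕ∞) f) (x : Cn n) :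
    V.act (W.act f) x = (∑ j, V.act (W.hol j) x * wz j f x) + (∑ j, V.act (W.anti j) x * wzb j f x)
      + ((∑ j, W.hol j x * V.act (wz j f) x) + ∑ j, W.anti j x * V.act (wzb j f) x) := by
  have h1 : ∀ j, ContDiff ℝ (⊤ : ℕ∞) fun y => W.hol j y * wz j f y :=
    fun j => (hW.1 j).mul (hf.wz j)
  have h2 : ∀ j, ContDiff ℝ (⊤ : ℕ∞) fun y => W.anti j y * wzb j f y :=
    fun j => (hW.2 j).mul (hf.wzb j)
  rw [show W.act f = fun y => (∑ j, W.hol j y * wz j f y) + ∑ j, W.anti j y * wzb j f y from rfl,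
    V.act_add (ContDiff.sum fun j _ => h1 j) (ContDiff.sum fun j _ => h2 j),
    V.act_sum _ h1, V.act_sum _ h2]
  simp only [V.act_mul (hW.1 _) (hf.wz _), V.act_mul (hW.2 _) (hf.wzb _),
    Finset.sum_add_distrib]
  ring

theorem act_bracket {V W : CVF n} (hV : V.Smooth) (hW : W.Smooth) {f : Cn n → ℂ}
    (hf : ContDiff ℝ (⊤ : ℕ∞) f) (x : Cn n) :
    (V.bracket W).act f x = V.act (W.act f) x - W.act (V.act f) x := by
  have key : ∀ A B : CVF n, (∑ j, A.hol j x * B.act (wz j f) x)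
      + (∑ j, A.anti j x * B.act (wzb j f) x)
      = (∑ j, B.hol j x * A.act (wz j f) x) + ∑ j, B.anti j x * A.act (wzb j f) x := by
    intro A B
    simp only [act, mul_add, Finset.mul_sum, ← Finset.sum_add_distrib]
    rw [Finset.sum_comm]
    refine Finset.sum_congr rfl fun j _ => Finset.sum_congr rfl fun k _ => ?_
    rw [wz_wz_comm hf j k, wzb_wzb_comm hf j k, wz_wzb_comm hf j k, ← wz_wzb_comm hf k j]
    ring
  rw [act_act V hW hf, act_act W hV hf, key V W]
  simp only [act, bracket, sub_mul, Finset.sum_sub_distrib]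
  ring

end CVF

end Wirtinger

section LeviForm

open ComplexConjugate

variable {n : ℕ}

/-- The Levi form at `x`, extended bilinearly to `ξ ∈ T^{1,0}` and `ζ ∈ T^{0,1}`. -/
noncomputable def leviBilin (ρ : Cn n → ℝ) (x : Cn n) (ξ ζ : Fin n → ℂ) : ℂ :=
  ∑ j, ∑ l, leviCoeff ρ j l x * ξ j * ζ l

theorem leviBilin_sub_left (ρ : Cn n → ℝ) (x : Cn n) (ξ ξ' ζ : Fin n → ℂ) :
    leviBilin ρ x (ξ - ξ') ζ = leviBilin ρ x ξ ζ - leviBilin ρ x ξ' ζ := by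
  simp only [leviBilin, ← Finset.sum_sub_distrib, Pi.sub_apply]
  refine Finset.sum_congr rfl fun j _ => Finset.sum_congr rfl fun l _ => ?_
  ring

theorem leviBilin_sub_right (ρ : Cn n → ℝ) (x : Cn n) (ξ ζ ζ' : Fin n → ℂ) :
    leviBilin ρ x ξ (ζ - ζ') = leviBilin ρ x ξ ζ - leviBilin ρ x ξ ζ' := by
  simp only [leviBilin, ← Finset.sum_sub_distrib, Pi.sub_apply]
  refine Finset.sum_congr rfl fun j _ => Finset.sum_congr rfl fun l _ => ?_
  ring

theorem leviBilin_smul_left (ρ : Cn n → ℝ) (x : Cn n) (c : ℂ) (ξ ζ : Fin n → ℂ) :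
    leviBilin ρ x (c • ξ) ζ = c * leviBilin ρ x ξ ζ := by
  simp only [leviBilin, Finset.mul_sum, Pi.smul_apply, smul_eq_mul]
  refine Finset.sum_congr rfl fun j _ => Finset.sum_congr rfl fun l _ => ?_
  ring

theorem leviBilin_smul_right (ρ : Cn n → ℝ) (x : Cn n) (c : ℂ) (ξ ζ : Fin n → ℂ) :
    leviBilin ρ x ξ (c • ζ) = c * leviBilin ρ x ξ ζ := by
  simp only [leviBilin, Finset.mul_sum, Pi.smul_apply, smul_eq_mul]
  refine Finset.sum_congr rfl fun j _ => Finset.sum_congr rfl fun l _ => ?_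
  ring

theorem ContDiff.leviCoeff {ρ : Cn n → ℝ} (hρ : ContDiff ℝ (⊤ : ℕ∞) ρ) (j l : Fin n) :
    ContDiff ℝ (⊤ : ℕ∞) (leviCoeff ρ j l) :=
  (hρ.cx.wzb l).wz j

theorem ContDiff.leviBilin {ρ : Cn n → ℝ} (hρ : ContDiff ℝ (⊤ : ℕ∞) ρ) {ξ ζ : Fin n → Cn n → ℂ}
    (hξ : ∀ j, ContDiff ℝ (⊤ : ℕ∞) (ξ j)) (hζ : ∀ j, ContDiff ℝ (⊤ : ℕ∞) (ζ j)) :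
    ContDiff ℝ (⊤ : ℕ∞) fun x => leviBilin ρ x (fun j => ξ j x) (fun j => ζ j x) :=
  ContDiff.sum fun j _ => ContDiff.sum fun l _ => ((hρ.leviCoeff j l).mul (hξ j)).mul (hζ l)

theorem star_leviCoeff {ρ : Cn n → ℝ} (hρ : ContDiff ℝ (⊤ : ℕ∞) ρ) (j l : Fin n) (x : Cn n) :
    conj (leviCoeff ρ j l x) = leviCoeff ρ l j x := by
  rw [leviCoeff, ← wzb_star (hρ.cx.wzb l), leviCoeff, wz_wzb_comm hρ.cx]
  congr 1
  funext y
  rw [wzb_cx hρ, Complex.conj_conj]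

theorem star_leviBilin {ρ : Cn n → ℝ} (hρ : ContDiff ℝ (⊤ : ℕ∞) ρ) (x : Cn n)
    (ξ ζ : Fin n → ℂ) :
    conj (leviBilin ρ x ξ ζ) = leviBilin ρ x (fun j => conj (ζ j)) (fun j => conj (ξ j)) := by
  simp only [leviBilin, map_sum, map_mul, star_leviCoeff hρ]
  rw [Finset.sum_comm]
  refine Finset.sum_congr rfl fun j _ => Finset.sum_congr rfl fun l _ => ?_
  ring

theorem CVF.act_leviBilin (V : CVF n) {ρ : Cn n → ℝ} (hρ : ContDiff ℝ (⊤ : ℕ∞) ρ)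
    {ξ ζ : Fin n → Cn n → ℂ} (hξ : ∀ j, ContDiff ℝ (⊤ : ℕ∞) (ξ j))
    (hζ : ∀ j, ContDiff ℝ (⊤ : ℕ∞) (ζ j)) (x : Cn n) :
    V.act (fun y => leviBilin ρ y (fun j => ξ j y) (fun j => ζ j y)) x
      = (∑ j, ∑ l, V.act (leviCoeff ρ j l) x * ξ j x * ζ l x)
        + leviBilin ρ x (fun j => V.act (ξ j) x) (fun j => ζ j x)
        + leviBilin ρ x (fun j => ξ j x) (fun j => V.act (ζ j) x) := by
  have h1 : ∀ j l, ContDiff ℝ (⊤ : ℕ∞) fun y => leviCoeff ρ j l y * ξ j y := fun j l =>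
    (hρ.leviCoeff j l).mul (hξ j)
  have h2 : ∀ j l, ContDiff ℝ (⊤ : ℕ∞) fun y => leviCoeff ρ j l y * ξ j y * ζ l y := fun j l =>
    (h1 j l).mul (hζ l)
  simp only [leviBilin]
  rw [V.act_sum _ fun j => ContDiff.sum fun l _ => h2 j l]
  simp only [V.act_sum _ (h2 _), V.act_mul (h1 _ _) (hζ _), V.act_mul (hρ.leviCoeff _ _) (hξ _),
    ← Finset.sum_add_distrib]
  refine Finset.sum_congr rfl fun j _ => Finset.sum_congr rfl fun l _ => ?_
  ring

/-- Symmetry of the third derivatives of `ρ` in two antiholomorphic directions. -/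
theorem wzb_leviCoeff_comm {ρ : Cn n → ℝ} (hρ : ContDiff ℝ (⊤ : ℕ∞) ρ) (j k l : Fin n)
    (x : Cn n) : wzb k (leviCoeff ρ j l) x = wzb l (leviCoeff ρ j k) x := by
  have h : ∀ k l : Fin n, wzb k (leviCoeff ρ j l) x = wz j (wzb k (wzb l (cx ρ))) x := fun k l =>
    (wz_wzb_comm (hρ.cx.wzb l) j k x).symm
  rw [h, h]
  congr 1
  funext y
  exact wzb_wzb_comm hρ.cx k l y

theorem CVF.Smooth.pairDRho {ρ : Cn n → ℝ} (hρ : ContDiff ℝ (⊤ : ℕ∞) ρ) {G : CVF n}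
    (hG : G.Smooth) : ContDiff ℝ (⊤ : ℕ∞) (pairDRho ρ G) :=
  ContDiff.sum fun j _ => (hG.1 j).mul (hρ.cx.wz j)

theorem pairDRho_bar {ρ : Cn n → ℝ} (hρ : ContDiff ℝ (⊤ : ℕ∞) ρ) (G : CVF n) (x : Cn n) :
    conj (pairDRho ρ G.bar x) = ∑ j, G.anti j x * wzb j (cx ρ) x := by
  simp [pairDRho, CVF.bar, wzb_cx hρ]

theorem act_cx_eq_pairDRho {ρ : Cn n → ℝ} (hρ : ContDiff ℝ (⊤ : ℕ∞) ρ) (G : CVF n) (x : Cn n) :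
    G.act (cx ρ) x = pairDRho ρ G x + conj (pairDRho ρ G.bar x) := by
  rw [pairDRho_bar hρ]; rfl

/-- Cartan's formula for `∂ρ` and the bracket of two vector fields. -/
theorem pairDRho_bracket {ρ : Cn n → ℝ} (hρ : ContDiff ℝ (⊤ : ℕ∞) ρ) {V G : CVF n}
    (hV : V.Smooth) (hG : G.Smooth) (x : Cn n) :
    pairDRho ρ (V.bracket G) x = V.act (pairDRho ρ G) x - G.act (pairDRho ρ V) x
      + leviBilin ρ x (fun j => V.hol j x) (fun j => G.anti j x)
      - leviBilin ρ x (fun j => G.hol j x) (fun j => V.anti j x) := by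
  have hexp : ∀ (A : CVF n) {B : CVF n}, B.Smooth → A.act (pairDRho ρ B) x
      = (∑ j, A.act (B.hol j) x * wz j (cx ρ) x)
        + (∑ j, ∑ k, A.hol k x * B.hol j x * wz k (wz j (cx ρ)) x)
        + leviBilin ρ x (fun j => B.hol j x) (fun j => A.anti j x) := by
    intro A B hB
    rw [show pairDRho ρ B = fun y => ∑ j, B.hol j y * wz j (cx ρ) y from rfl,
      A.act_sum _ fun j => (hB.1 j).mul (hρ.cx.wz j)]
    simp only [A.act_mul (hB.1 _) (hρ.cx.wz _), Finset.sum_add_distrib, add_assoc]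
    congr 1
    simp only [leviBilin, ← Finset.sum_add_distrib]
    refine Finset.sum_congr rfl fun j _ => ?_
    simp only [CVF.act, leviCoeff, mul_add, Finset.mul_sum, wz_wzb_comm hρ.cx]
    rw [Finset.sum_add_distrib]
    congr 1 <;> refine Finset.sum_congr rfl fun k _ => by ring
  have hsymm : (∑ j, ∑ k, V.hol k x * G.hol j x * wz k (wz j (cx ρ)) x)
      = ∑ j, ∑ k, G.hol k x * V.hol j x * wz k (wz j (cx ρ)) x := by
    rw [Finset.sum_comm]
    refine Finset.sum_congr rfl fun j _ => Finset.sum_congr rfl fun k _ => ?_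
    rw [wz_wz_comm hρ.cx]; ring
  rw [hexp V hG, hexp G hV, hsymm]
  simp only [pairDRho, CVF.bracket, sub_mul, Finset.sum_sub_distrib]
  ring

end LeviForm

section CRGeometry

open ComplexConjugate

variable {n : ℕ} {ρ : Cn n → ℝ} {a : Fin n → Cn n → ℂ}

theorem fderiv_re_comp {f : Cn n → ℂ} (hf : ContDiff ℝ (⊤ : ℕ∞) f) (x v : Cn n) :
    fderiv ℝ (fun y => (f y).re) x v = (fderiv ℝ f x v).re := by
  have := Complex.reCLM.hasFDerivAt.comp x ((hf.differentiable (by simp)) x).hasFDerivAt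
  rw [show (fun y => (f y).re) = Complex.reCLM ∘ f from rfl, this.fderiv]
  simp

theorem fderiv_im_comp {f : Cn n → ℂ} (hf : ContDiff ℝ (⊤ : ℕ∞) f) (x v : Cn n) :
    fderiv ℝ (fun y => (f y).im) x v = (fderiv ℝ f x v).im := by
  have := Complex.imCLM.hasFDerivAt.comp x ((hf.differentiable (by simp)) x).hasFDerivAt
  rw [show (fun y => (f y).im) = Complex.imCLM ∘ f from rfl, this.fderiv]
  simp

/-- A smooth pseudoconvex hypersurface `{ρ = 0}` with a CR field `Σ a_j ∂/∂z_j`. -/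
structure IsPseudoconvexCR (ρ : Cn n → ℝ) (a : Fin n → Cn n → ℂ) : Prop where
  smooth : ContDiff ℝ (⊤ : ℕ∞) ρ
  regular : ∀ x, ρ x = 0 → fderiv ℝ ρ x ≠ 0
  levi_nonneg : ∀ x, ρ x = 0 → ∀ ξ : Fin n → ℂ, (∑ j, ξ j * wz j (cx ρ) x) = 0 →
    0 ≤ (leviBilin ρ x ξ fun j => conj (ξ j)).re
  smooth_field : ∀ j, ContDiff ℝ (⊤ : ℕ∞) (a j)
  tangent : ∀ x, ρ x = 0 → ∑ j, a j x * wz j (cx ρ) x = 0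

namespace CVF

/-- `V` is tangent to `{ρ = 0}`. -/
def Tangent (ρ : Cn n → ℝ) (V : CVF n) : Prop := ∀ x, ρ x = 0 → V.act (cx ρ) x = 0

theorem fderiv_parts_eq_zero (hρ : ContDiff ℝ (⊤ : ℕ∞) ρ) {V : CVF n} {x : Cn n}
    (hV : V.act (cx ρ) x = 0) :
    fderiv ℝ ρ x (V.rePart x) = 0 ∧ fderiv ℝ ρ x (V.imPart x) = 0 := by
  rw [act_eq_fderiv, fderiv_cx hρ, fderiv_cx hρ] at hV
  have h1 := congrArg Complex.re hV
  have h2 := congrArg Complex.im hV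
  simp at h1 h2
  exact ⟨h1, h2⟩

theorem act_eq_zero_of_eq_zero (h : IsPseudoconvexCR ρ a) {V : CVF n} {x : Cn n} (hx : ρ x = 0)
    (hV : V.act (cx ρ) x = 0) {f : Cn n → ℂ} (hf : ContDiff ℝ (⊤ : ℕ∞) f)
    (hzero : ∀ y, ρ y = 0 → f y = 0) : V.act f x = 0 := by
  have key : ∀ w, fderiv ℝ ρ x w = 0 → fderiv ℝ f x w = 0 := fun w hw => by
    apply Complex.ext
    · rw [← fderiv_re_comp hf]
      exact fderiv_eq_zero_of_eq_zero_on_zeroLocus h.smooth hx (h.regular x hx)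
        (Complex.reCLM.contDiff.comp hf) (fun y hy => by simp [hzero y hy]) hw
    · rw [← fderiv_im_comp hf]
      exact fderiv_eq_zero_of_eq_zero_on_zeroLocus h.smooth hx (h.regular x hx)
        (Complex.imCLM.contDiff.comp hf) (fun y hy => by simp [hzero y hy]) hw
  obtain ⟨h1, h2⟩ := fderiv_parts_eq_zero h.smooth hV
  rw [act_eq_fderiv, key _ h1, key _ h2]
  simp

theorem act_congr_of_eq (h : IsPseudoconvexCR ρ a) {V : CVF n} {x : Cn n} (hx : ρ x = 0)
    (hV : V.act (cx ρ) x = 0) {f g : Cn n → ℂ} (hf : ContDiff ℝ (⊤ : ℕ∞) f)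
    (hg : ContDiff ℝ (⊤ : ℕ∞) g) (heq : ∀ y, ρ y = 0 → f y = g y) : V.act f x = V.act g x := by
  rw [← sub_eq_zero, ← V.act_sub hf hg]
  exact act_eq_zero_of_eq_zero h hx hV (hf.sub hg) fun y hy => sub_eq_zero.mpr (heq y hy)

theorem act_cx_eq_zero_of_nonneg (h : IsPseudoconvexCR ρ a) {V : CVF n} {x : Cn n} (hx : ρ x = 0)
    (hV : V.act (cx ρ) x = 0) {f : Cn n → ℝ} (hf : ContDiff ℝ (⊤ : ℕ∞) f)
    (hnonneg : ∀ y, ρ y = 0 → 0 ≤ f y) (hfx : f x = 0) : V.act (cx f) x = 0 := by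
  obtain ⟨h1, h2⟩ := fderiv_parts_eq_zero h.smooth hV
  rw [act_eq_fderiv, fderiv_cx hf, fderiv_cx hf,
    fderiv_eq_zero_of_nonneg_on_zeroLocus h.smooth hx (h.regular x hx) hf hnonneg hfx h1,
    fderiv_eq_zero_of_nonneg_on_zeroLocus h.smooth hx (h.regular x hx) hf hnonneg hfx h2]
  simp

theorem Tangent.bracket (h : IsPseudoconvexCR ρ a) {V W : CVF n} (hVs : V.Smooth) (hWs : W.Smooth)
    (hV : V.Tangent ρ) (hW : W.Tangent ρ) : (V.bracket W).Tangent ρ := fun x hx => by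
  rw [act_bracket hVs hWs h.smooth.cx,
    act_eq_zero_of_eq_zero h hx (hV x hx) (hWs.act h.smooth.cx) hW,
    act_eq_zero_of_eq_zero h hx (hW x hx) (hVs.act h.smooth.cx) hV, sub_zero]

end CVF

theorem InM1.act_eq {V : CVF n} {c₁ c₂ : Cn n → ℂ} (h₁ : ∀ j x, V.hol j x = c₁ x * a j x)
    (h₂ : ∀ j x, V.anti j x = c₂ x * conj (a j x)) (f : Cn n → ℂ) (x : Cn n) :
    V.act f x = c₁ x * (LVF a).act f x + c₂ x * (LbarVF a).act f x := by
  simp [CVF.act, LVF, LbarVF, h₁, h₂, Finset.mul_sum, mul_assoc]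

theorem inM1_LVF (a : Fin n → Cn n → ℂ) : InM1 a (LVF a) :=
  ⟨fun _ => 1, fun _ => 0, contDiff_const, contDiff_const, by simp [LVF], by simp [LVF]⟩

theorem inM1_LbarVF (a : Fin n → Cn n → ℂ) : InM1 a (LbarVF a) :=
  ⟨fun _ => 0, fun _ => 1, contDiff_const, contDiff_const, by simp [LbarVF], by simp [LbarVF]⟩

theorem InM1.bar {V : CVF n} (hV : InM1 a V) : InM1 a V.bar := by
  obtain ⟨c₁, c₂, hc₁, hc₂, h₁, h₂⟩ := hV
  exact ⟨_, _, hc₂.star_comp, hc₁.star_comp, fun j x => by simp [CVF.bar, h₂],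
    fun j x => by simp [CVF.bar, h₁]⟩

end CRGeometry

namespace IsPseudoconvexCR

open ComplexConjugate

variable {n : ℕ} {ρ : Cn n → ℝ} {a : Fin n → Cn n → ℂ}

theorem smooth_of_inM1 (h : IsPseudoconvexCR ρ a) {V : CVF n} (hV : InM1 a V) : V.Smooth := by
  obtain ⟨c₁, c₂, hc₁, hc₂, h₁, h₂⟩ := hV
  refine ⟨fun j => ?_, fun j => ?_⟩
  · rw [show V.hol j = fun x => c₁ x * a j x from funext (h₁ j)]
    exact hc₁.mul (h.smooth_field j)
  · rw [show V.anti j = fun x => c₂ x * conj (a j x) from funext (h₂ j)]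
    exact hc₂.mul (h.smooth_field j).star_comp

theorem pairDRho_of_inM1 (h : IsPseudoconvexCR ρ a)
    {V : CVF n} (hV : InM1 a V) {x : Cn n} (hx : ρ x = 0) :
    pairDRho ρ V x = 0 := by
  obtain ⟨c₁, c₂, hc₁, hc₂, h₁, h₂⟩ := hV
  simp only [pairDRho, h₁, mul_assoc, ← Finset.mul_sum, h.tangent x hx, mul_zero]

theorem tangent_of_inM1 (h : IsPseudoconvexCR ρ a)
    {V : CVF n} (hV : InM1 a V) : V.Tangent ρ := fun x hx => by
  rw [act_cx_eq_pairDRho h.smooth, h.pairDRho_of_inM1 hV hx, h.pairDRho_of_inM1 hV.bar hx]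
  simp

theorem smooth_tangent_of_isCommOf (h : IsPseudoconvexCR ρ a)
    {k : ℕ} {G : CVF n} (hG : IsCommOf a k G) :
    G.Smooth ∧ G.Tangent ρ := by
  induction hG with
  | one W hW => exact ⟨h.smooth_of_inM1 hW, h.tangent_of_inM1 hW⟩
  | succ V W hV _ ih =>
    exact ⟨(h.smooth_of_inM1 hV).bracket ih.1,
      CVF.Tangent.bracket h (h.smooth_of_inM1 hV) ih.1 (h.tangent_of_inM1 hV) ih.2⟩

theorem smooth_levi (h : IsPseudoconvexCR ρ a) : ContDiff ℝ (⊤ : ℕ∞) (levi ρ a a) :=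
  h.smooth.leviBilin h.smooth_field fun j => (h.smooth_field j).star_comp

theorem cx_levi_re (h : IsPseudoconvexCR ρ a) : cx (fun x => (levi ρ a a x).re) = levi ρ a a := by
  funext x
  refine Complex.conj_eq_iff_re.mp ?_
  rw [show levi ρ a a x = leviBilin ρ x (fun j => a j x) (fun j => conj (a j x)) from rfl,
    star_leviBilin h.smooth]
  simp

theorem levi_re_nonneg (h : IsPseudoconvexCR ρ a)
    {x : Cn n} (hx : ρ x = 0) : 0 ≤ (levi ρ a a x).re :=
  h.levi_nonneg x hx _ (h.tangent x hx)

/-- Cauchy–Schwarz for the Levi form. -/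
theorem normSq_leviBilin_le (h : IsPseudoconvexCR ρ a) {x : Cn n} (hx : ρ x = 0) {ξ : Fin n → ℂ}
    (hξ : ∑ j, ξ j * wz j (cx ρ) x = 0) :
    Complex.normSq (leviBilin ρ x ξ fun j => conj (a j x))
      ≤ ((leviBilin ρ x ξ fun j => conj (ξ j)).re + 1) * (levi ρ a a x).re := by
  have hlev : levi ρ a a x = leviBilin ρ x (fun j => a j x) (fun j => conj (a j x)) := rfl
  have hstar := star_leviBilin h.smooth x ξ fun j => conj (a j x)
  have hq := h.levi_nonneg x hx ξ hξ
  have hl := h.levi_re_nonneg hx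
  set f := leviBilin ρ x ξ fun j => conj (a j x) with hf
  set q := leviBilin ρ x ξ fun j => conj (ξ j) with hqdef
  simp only [Complex.conj_conj] at hstar
  set s : ℝ := q.re + 1 with hs
  have hcr : ∑ j, ((s : ℂ) • (fun j => a j x) - conj f • ξ) j * wz j (cx ρ) x = 0 := by
    simp only [Pi.sub_apply, Pi.smul_apply, smul_eq_mul, sub_mul, Finset.sum_sub_distrib,
      mul_assoc, ← Finset.mul_sum, hξ, h.tangent x hx, mul_zero, sub_zero]
  have hpos := h.levi_nonneg x hx _ hcr
  have hconj : (fun j => conj (((s : ℂ) • (fun j => a j x) - conj f • ξ) j))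
      = (s : ℂ) • (fun j => conj (a j x)) - f • fun j => conj (ξ j) := by
    funext j; simp
  rw [hconj, leviBilin_sub_left, leviBilin_sub_right, leviBilin_sub_right, leviBilin_smul_left,
    leviBilin_smul_left, leviBilin_smul_left, leviBilin_smul_left, leviBilin_smul_right,
    leviBilin_smul_right, leviBilin_smul_right, leviBilin_smul_right, ← hlev, ← hstar, ← hf,
    ← hqdef] at hpos
  have him : (levi ρ a a x).im = 0 := by rw [← h.cx_levi_re]; simp [cx]
  have hqim : q.im = 0 := by
    rw [← Complex.conj_eq_iff_im, hqdef, star_leviBilin h.smooth]; simp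
  simp only [Complex.sub_re, Complex.mul_re, Complex.mul_im, Complex.conj_re, Complex.conj_im,
    Complex.ofReal_re, Complex.ofReal_im, him, hqim] at hpos
  rw [Complex.normSq_apply]
  have hspos : 0 < s := by positivity
  refine le_of_mul_le_mul_left ?_ hspos
  have : q.re = s - 1 := by rw [hs]; ring
  rw [this] at hpos
  nlinarith [mul_self_nonneg f.re, mul_self_nonneg f.im]

theorem leviBilin_left_eq_zero (h : IsPseudoconvexCR ρ a) {p : Cn n} (hp : ρ p = 0)
    (hlam : levi ρ a a p = 0) {ξ : Fin n → ℂ}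
    (hξ : ∑ j, ξ j * wz j (cx ρ) p = 0) : leviBilin ρ p ξ (fun j => conj (a j p)) = 0 := by
  have := h.normSq_leviBilin_le hp hξ
  rw [hlam, Complex.zero_re, mul_zero] at this
  exact Complex.normSq_eq_zero.mp (le_antisymm this (Complex.normSq_nonneg _))

theorem leviBilin_right_eq_zero (h : IsPseudoconvexCR ρ a) {p : Cn n} (hp : ρ p = 0)
    (hlam : levi ρ a a p = 0) {ζ : Fin n → ℂ}
    (hζ : ∑ j, ζ j * wzb j (cx ρ) p = 0) : leviBilin ρ p (fun j => a j p) ζ = 0 := by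
  rw [← map_eq_zero (starRingEnd ℂ), star_leviBilin h.smooth]
  refine h.leviBilin_left_eq_zero hp hlam ?_
  rw [← map_eq_zero (starRingEnd ℂ)]
  simpa [wzb_cx h.smooth] using hζ

theorem act_levi_eq_zero (h : IsPseudoconvexCR ρ a) {p : Cn n} (hp : ρ p = 0)
    (hlam : levi ρ a a p = 0) {V : CVF n} (hV : V.act (cx ρ) p = 0) :
    V.act (levi ρ a a) p = 0 := by
  rw [← h.cx_levi_re]
  exact CVF.act_cx_eq_zero_of_nonneg h hp hV (Complex.reCLM.contDiff.comp h.smooth_levi)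
    (fun y hy => h.levi_re_nonneg hy) (by simp [hlam])

theorem leviBilin_hol_eq_zero (h : IsPseudoconvexCR ρ a) {p : Cn n} (hp : ρ p = 0)
    (hlam : levi ρ a a p = 0) {G : CVF n}
    (hGp : pairDRho ρ G p = 0) :
    leviBilin ρ p (fun j => G.hol j p) (fun j => conj (a j p)) = 0 :=
  h.leviBilin_left_eq_zero hp hlam hGp

theorem pairDRho_bar_eq (h : IsPseudoconvexCR ρ a) {p : Cn n} (hp : ρ p = 0)
    {G : CVF n} (hG : G.Tangent ρ) :
    pairDRho ρ G.bar p = -conj (pairDRho ρ G p) := by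
  have := hG p hp
  rw [act_cx_eq_pairDRho h.smooth] at this
  rw [← Complex.conj_conj (pairDRho ρ G.bar p), eq_neg_of_add_eq_zero_right this, map_neg]

theorem leviBilin_anti_eq_zero (h : IsPseudoconvexCR ρ a) {p : Cn n} (hp : ρ p = 0)
    (hlam : levi ρ a a p = 0) {G : CVF n} (hG : G.Tangent ρ)
    (hGp : pairDRho ρ G p = 0) :
    leviBilin ρ p (fun j => a j p) (fun j => G.anti j p) = 0 := by
  refine h.leviBilin_right_eq_zero hp hlam ?_
  rw [← pairDRho_bar h.smooth, h.pairDRho_bar_eq hp hG, hGp]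
  simp

theorem pairDRho_bracket_inM1 (h : IsPseudoconvexCR ρ a)
    {V G : CVF n} (hV : InM1 a V) {c₁ c₂ : Cn n → ℂ}
    (h₁ : ∀ j x, V.hol j x = c₁ x * a j x) (h₂ : ∀ j x, V.anti j x = c₂ x * conj (a j x))
    (hGs : G.Smooth) (hG : G.Tangent ρ) {x : Cn n} (hx : ρ x = 0) :
    pairDRho ρ (V.bracket G) x = V.act (pairDRho ρ G) x
      + c₁ x * leviBilin ρ x (fun j => a j x) (fun j => G.anti j x)
      - c₂ x * leviBilin ρ x (fun j => G.hol j x) (fun j => conj (a j x)) := by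
  rw [pairDRho_bracket h.smooth (h.smooth_of_inM1 hV) hGs,
    CVF.act_eq_zero_of_eq_zero h hx (hG x hx) ((h.smooth_of_inM1 hV).pairDRho h.smooth)
      (fun y hy => h.pairDRho_of_inM1 hV hy), sub_zero, ← leviBilin_smul_left,
    ← leviBilin_smul_right]
  simp only [h₁, h₂]
  rfl

theorem pairDRho_bracket_of_eq_zero (h : IsPseudoconvexCR ρ a) {p : Cn n} (hp : ρ p = 0)
    (hlam : levi ρ a a p = 0) {V G : CVF n} (hV : InM1 a V)
    (hGs : G.Smooth) (hG : G.Tangent ρ) (hGp : pairDRho ρ G p = 0) :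
    pairDRho ρ (V.bracket G) p = V.act (pairDRho ρ G) p := by
  have hV' := hV
  obtain ⟨c₁, c₂, hc₁, hc₂, h₁, h₂⟩ := hV
  rw [h.pairDRho_bracket_inM1 hV' h₁ h₂ hGs hG hp, h.leviBilin_anti_eq_zero hp hlam hG hGp,
    h.leviBilin_hol_eq_zero hp hlam hGp]
  ring

theorem exists_pairDRho_length_two (h : IsPseudoconvexCR ρ a) {G : CVF n} (hG : IsCommOf a 2 G) :
    ∃ c : Cn n → ℂ, ContDiff ℝ (⊤ : ℕ∞) c ∧
      ∀ x, ρ x = 0 → pairDRho ρ G x = c x * levi ρ a a x := by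
  cases hG with
  | succ V W hV hW =>
  cases hW with
  | succ _ _ _ hW => cases hW
  | one _ hW =>
  have hV' := hV
  have hW' := hW
  obtain ⟨c₁, c₂, hc₁, hc₂, h₁, h₂⟩ := hV
  obtain ⟨d₁, d₂, hd₁, hd₂, k₁, k₂⟩ := hW
  refine ⟨fun x => c₁ x * d₂ x - c₂ x * d₁ x, by fun_prop, fun x hx => ?_⟩
  rw [h.pairDRho_bracket_inM1 hV' h₁ h₂ (h.smooth_of_inM1 hW') (h.tangent_of_inM1 hW') hx,
    CVF.act_eq_zero_of_eq_zero h hx (h.tangent_of_inM1 hV' x hx)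
      ((h.smooth_of_inM1 hW').pairDRho h.smooth) (fun y hy => h.pairDRho_of_inM1 hW' hy)]
  have e1 : (fun j => W.anti j x) = d₂ x • fun j => conj (a j x) := funext fun j => k₂ j x
  have e2 : (fun j => W.hol j x) = d₁ x • fun j => a j x := funext fun j => k₁ j x
  rw [e1, e2, leviBilin_smul_right, leviBilin_smul_left,
    show levi ρ a a x = leviBilin ρ x (fun j => a j x) (fun j => conj (a j x)) from rfl]
  ring

theorem pairDRho_length_two_eq_zero (h : IsPseudoconvexCR ρ a) {p : Cn n} (hp : ρ p = 0)
    (hlam : levi ρ a a p = 0) {G : CVF n}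
    (hG : IsCommOf a 2 G) : pairDRho ρ G p = 0 := by
  obtain ⟨c, _, hc⟩ := h.exists_pairDRho_length_two hG
  rw [hc p hp, hlam, mul_zero]

/-- Tangential first derivatives of `⟨∂ρ, G⟩` at a point where the Levi form vanishes on `L`. -/
theorem act_pairDRho_length_two_eq_zero (h : IsPseudoconvexCR ρ a) {p : Cn n} (hp : ρ p = 0)
    (hlam : levi ρ a a p = 0) {G : CVF n}
    (hG : IsCommOf a 2 G) {V : CVF n} (hV : V.act (cx ρ) p = 0) :
    V.act (pairDRho ρ G) p = 0 := by
  obtain ⟨c, hcs, hc⟩ := h.exists_pairDRho_length_two hG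
  rw [CVF.act_congr_of_eq h hp hV ((h.smooth_tangent_of_isCommOf hG).1.pairDRho h.smooth)
    (hcs.mul h.smooth_levi) hc, V.act_mul hcs h.smooth_levi, hlam,
    h.act_levi_eq_zero hp hlam hV]
  ring

theorem pairDRho_length_three_eq_zero (h : IsPseudoconvexCR ρ a) {p : Cn n} (hp : ρ p = 0)
    (hlam : levi ρ a a p = 0) {G : CVF n}
    (hG : IsCommOf a 3 G) : pairDRho ρ G p = 0 := by
  cases hG with
  | succ V W hV hW =>
  have hWst := h.smooth_tangent_of_isCommOf hW
  rw [h.pairDRho_bracket_of_eq_zero hp hlam hV hWst.1 hWst.2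
    (h.pairDRho_length_two_eq_zero hp hlam hW)]
  exact h.act_pairDRho_length_two_eq_zero hp hlam hW (h.tangent_of_inM1 hV p hp)

end IsPseudoconvexCR

section SecondOrder

open ComplexConjugate

variable {n : ℕ} {ρ : Cn n → ℝ} {a : Fin n → Cn n → ℂ}

/-- The real vector field `cL + c̄L̄`, for a constant `c`. -/
noncomputable def realField (a : Fin n → Cn n → ℂ) (c : ℂ) : CVF n where
  hol := fun j x => c * a j x
  anti := fun j x => conj c * conj (a j x)

theorem inM1_realField (a : Fin n → Cn n → ℂ) (c : ℂ) : InM1 a (realField a c) :=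
  ⟨fun _ => c, fun _ => conj c, contDiff_const, contDiff_const, fun _ _ => rfl, fun _ _ => rfl⟩

theorem realField_act (c : ℂ) (f : Cn n → ℂ) (x : Cn n) :
    (realField a c).act f x = c * (LVF a).act f x + conj c * (LbarVF a).act f x :=
  InM1.act_eq (c₁ := fun _ => c) (c₂ := fun _ => conj c) (fun _ _ => rfl) (fun _ _ => rfl) f x

theorem realField_act_cx (c : ℂ) {f : Cn n → ℝ} (hf : ContDiff ℝ (⊤ : ℕ∞) f) :
    (realField a c).act (cx f) = cx fun x => fderiv ℝ f x fun j => c * a j x := by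
  funext x
  have hre : (realField a c).rePart x = fun j => c * a j x := by
    funext j; simp [CVF.rePart, realField]
  have him : (realField a c).imPart x = 0 := by
    funext j; simp [CVF.imPart, realField]
  rw [CVF.act_eq_fderiv, hre, him, fderiv_cx hf, map_zero, mul_zero, add_zero]
  rfl

theorem LVF_bar : (LVF a).bar = LbarVF a := by
  simp [CVF.bar, LVF, LbarVF]

theorem LbarVF_bar : (LbarVF a).bar = LVF a := by
  simp [CVF.bar, LVF, LbarVF]

end SecondOrder

namespace IsPseudoconvexCR

open ComplexConjugate

variable {n : ℕ} {ρ : Cn n → ℝ} {a : Fin n → Cn n → ℂ}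

theorem realField_act_act_re_nonneg (h : IsPseudoconvexCR ρ a) {p : Cn n} (hp : ρ p = 0)
    {f : Cn n → ℝ} (hf : ContDiff ℝ (⊤ : ℕ∞) f)
    (hnonneg : ∀ y, ρ y = 0 → 0 ≤ f y) (hfp : f p = 0) (c : ℂ) :
    0 ≤ ((realField a c).act ((realField a c).act (cx f)) p).re := by
  have hX : ContDiff ℝ (⊤ : ℕ∞) fun x => (fun j => c * a j x : Cn n) :=
    contDiff_pi.mpr fun j => contDiff_const.mul (h.smooth_field j)
  have hdf : ContDiff ℝ (⊤ : ℕ∞) (fderiv ℝ f) := hf.fderiv_right (by simp)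
  rw [realField_act_cx c hf, realField_act_cx c (hdf.clm_apply hX)]
  refine fderiv_fderiv_nonneg_on_zeroLocus h.smooth hp (h.regular p hp) hf hnonneg hfp hX
    fun x hx => ?_
  have := h.tangent_of_inM1 (inM1_realField a c) x hx
  rw [realField_act_cx c h.smooth] at this
  exact Complex.ofReal_eq_zero.mp this

theorem smooth_LVF (h : IsPseudoconvexCR ρ a) : (LVF a).Smooth := h.smooth_of_inM1 (inM1_LVF a)

theorem smooth_LbarVF (h : IsPseudoconvexCR ρ a)
    : (LbarVF a).Smooth := h.smooth_of_inM1 (inM1_LbarVF a)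

theorem act_inM1_act (h : IsPseudoconvexCR ρ a)
    (V : CVF n) {W : CVF n} {d₁ d₂ : Cn n → ℂ} (hd₁ : ContDiff ℝ (⊤ : ℕ∞) d₁)
    (hd₂ : ContDiff ℝ (⊤ : ℕ∞) d₂) (k₁ : ∀ j x, W.hol j x = d₁ x * a j x)
    (k₂ : ∀ j x, W.anti j x = d₂ x * conj (a j x)) {f : Cn n → ℂ}
    (hf : ContDiff ℝ (⊤ : ℕ∞) f) (x : Cn n) :
    V.act (W.act f) x = V.act d₁ x * (LVF a).act f x + d₁ x * V.act ((LVF a).act f) x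
      + (V.act d₂ x * (LbarVF a).act f x + d₂ x * V.act ((LbarVF a).act f) x) := by
  have h1 := h.smooth_LVF.act hf
  have h2 := h.smooth_LbarVF.act hf
  rw [show W.act f = fun y => d₁ y * (LVF a).act f y + d₂ y * (LbarVF a).act f y from
    funext fun y => InM1.act_eq k₁ k₂ f y, V.act_add (hd₁.mul h1) (hd₂.mul h2),
    V.act_mul hd₁ h1, V.act_mul hd₂ h2]

theorem LVF_act_LbarVF_act_levi (h : IsPseudoconvexCR ρ a) {p : Cn n} (hp : ρ p = 0)
    (hlam : levi ρ a a p = 0) :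
    (LVF a).act ((LbarVF a).act (levi ρ a a)) p = (LbarVF a).act ((LVF a).act (levi ρ a a)) p := by
  rw [← sub_eq_zero, ← CVF.act_bracket h.smooth_LVF h.smooth_LbarVF h.smooth_levi]
  exact h.act_levi_eq_zero hp hlam
    (CVF.Tangent.bracket h h.smooth_LVF h.smooth_LbarVF (h.tangent_of_inM1 (inM1_LVF a))
      (h.tangent_of_inM1 (inM1_LbarVF a)) p hp)

theorem act_levi_star (h : IsPseudoconvexCR ρ a) (V : CVF n) (x : Cn n) :
    conj (V.act (levi ρ a a) x) = V.bar.act (levi ρ a a) x := by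
  have hself : (fun y => conj (levi ρ a a y)) = levi ρ a a := by
    conv_lhs => rw [← h.cx_levi_re]
    rw [← h.cx_levi_re]
    simp [cx]
    rfl
  have := V.bar.act_star h.smooth_levi x
  rw [hself] at this
  simpa [CVF.bar] using this.symm

/-- At a zero of the Levi form on `L`, either all second derivatives of the Levi form along
`𝓜₁(L)` vanish or `L̄ L λ(L,L) > 0`. -/
theorem second_order_dichotomy (h : IsPseudoconvexCR ρ a) {p : Cn n} (hp : ρ p = 0)
    (hlam : levi ρ a a p = 0) :
    (∀ V W, InM1 a V → InM1 a W → V.act (W.act (levi ρ a a)) p = 0) ∨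
      0 < ((LbarVF a).act ((LVF a).act (levi ρ a a)) p).re := by
  set lam := levi ρ a a with hlamdef
  have hs : ContDiff ℝ (⊤ : ℕ∞) lam := h.smooth_levi
  have hL : (LVF a).act lam p = 0 :=
    h.act_levi_eq_zero hp hlam (h.tangent_of_inM1 (inM1_LVF a) p hp)
  have hLb : (LbarVF a).act lam p = 0 :=
    h.act_levi_eq_zero hp hlam (h.tangent_of_inM1 (inM1_LbarVF a) p hp)
  have hcomm := h.LVF_act_LbarVF_act_levi hp hlam
  rw [← hlamdef] at hcomm
  have hbar : ∀ V W : CVF n, W.Smooth →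
      conj (V.act (W.act lam) p) = V.bar.act (W.bar.act lam) p := by
    intro V W hW
    rw [show W.bar.act lam = fun y => conj (W.act lam y) from
      funext fun y => (h.act_levi_star W y).symm, CVF.act_star _ (hW.act hs)]
    simp [CVF.bar]
  set α := (LbarVF a).act ((LVF a).act lam) p with hα
  set β := (LVF a).act ((LVF a).act lam) p with hβ
  set β' := (LbarVF a).act ((LbarVF a).act lam) p with hβ'
  have hββ : conj β = β' := by rw [hβ, hbar _ _ h.smooth_LVF, LVF_bar]
  have hαα : conj α = α := by
    rw [hα, hbar _ _ h.smooth_LVF, LVF_bar, LbarVF_bar, hcomm]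
  have hquad : ∀ c : ℂ, 0 ≤ (c * (c * β + conj c * α) + conj c * (c * α + conj c * β')).re := by
    intro c
    have := h.realField_act_act_re_nonneg hp (Complex.reCLM.contDiff.comp hs)
      (fun y hy => h.levi_re_nonneg hy) (by simp [hlam]) c
    rw [show cx (Complex.reCLM ∘ lam) = lam from h.cx_levi_re,
      h.act_inM1_act (realField a c) (W := realField a c) (d₁ := fun _ => c)
        (d₂ := fun _ => conj c) contDiff_const contDiff_const (fun _ _ => rfl) (fun _ _ => rfl) hs,
      hL, hLb, realField_act, realField_act, realField_act, realField_act, hcomm] at this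
    refine this.trans_eq (congrArg Complex.re ?_)
    ring
  by_cases hpos : 0 < α.re
  · exact Or.inr hpos
  left
  have q1 := hquad 1
  have q2 := hquad Complex.I
  have q3 := hquad (1 + Complex.I)
  have q4 := hquad (1 - Complex.I)
  have hαim : α.im = 0 := Complex.conj_eq_iff_im.mp hαα
  rw [← hββ] at q1 q2 q3 q4
  simp [hαim] at q1 q2 q3 q4
  push Not at hpos
  have hαz : α = 0 := Complex.ext (by simp only [Complex.zero_re]; linarith) hαim
  have hαre : α.re = 0 := by simp [hαz]
  have hβz : β = 0 := Complex.ext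
    (by simp only [Complex.zero_re]; linarith) (by simp only [Complex.zero_im]; linarith)
  have hβz' : β' = 0 := by rw [← hββ, hβz, map_zero]
  intro V W hV hW
  obtain ⟨c₁, c₂, hc₁, hc₂, h₁, h₂⟩ := hV
  obtain ⟨d₁, d₂, hd₁, hd₂, k₁, k₂⟩ := hW
  rw [h.act_inM1_act V hd₁ hd₂ k₁ k₂ hs, hL, hLb, InM1.act_eq h₁ h₂, InM1.act_eq h₁ h₂,
    InM1.act_eq h₁ h₂, InM1.act_eq h₁ h₂, hcomm, ← hα, ← hβ, ← hβ', hαz, hβz, hβz']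
  ring

/-- Under flatness of the Levi form to second order, `λ(X, L)` is flat to first order along
`𝓜₁(L)` for `X` of type `(1,0)` annihilated by `∂ρ` on `{ρ = 0}`. -/
theorem act_leviBilin_eq_zero_of_CR (h : IsPseudoconvexCR ρ a) {p : Cn n} (hp : ρ p = 0)
    (hlam : levi ρ a a p = 0)
    (hflat : ∀ V W, InM1 a V → InM1 a W → V.act (W.act (levi ρ a a)) p = 0)
    {ξ : Fin n → Cn n → ℂ} (hξ : ∀ j, ContDiff ℝ (⊤ : ℕ∞) (ξ j))
    (hCR : ∀ x, ρ x = 0 → ∑ j, ξ j x * wz j (cx ρ) x = 0) {V : CVF n} (hV : InM1 a V) :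
    V.act (fun x => leviBilin ρ x (fun j => ξ j x) (fun j => conj (a j x))) p = 0 := by
  set f : Cn n → ℂ := fun x => leviBilin ρ x (fun j => ξ j x) (fun j => conj (a j x)) with hfdef
  have hf : ContDiff ℝ (⊤ : ℕ∞) f :=
    h.smooth.leviBilin hξ fun j => (h.smooth_field j).star_comp
  set q : Cn n → ℝ := fun x => (leviBilin ρ x (fun j => ξ j x) (fun j => conj (ξ j x))).re + 1
    with hqdef
  have hq : ContDiff ℝ (⊤ : ℕ∞) q := (Complex.reCLM.contDiff.comp
    (h.smooth.leviBilin hξ fun j => (hξ j).star_comp)).add contDiff_const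
  have hs := h.smooth_levi
  have hsre : ContDiff ℝ (⊤ : ℕ∞) fun x => (levi ρ a a x).re := Complex.reCLM.contDiff.comp hs
  have hfre : ContDiff ℝ (⊤ : ℕ∞) fun x => (f x).re := Complex.reCLM.contDiff.comp hf
  have hfim : ContDiff ℝ (⊤ : ℕ∞) fun x => (f x).im := Complex.imCLM.contDiff.comp hf
  set g : Cn n → ℝ := fun x => q x * (levi ρ a a x).re - Complex.normSq (f x) with hgdef
  have hg : ContDiff ℝ (⊤ : ℕ∞) g := by
    simp only [hgdef, Complex.normSq_apply]
    exact (hq.mul hsre).sub ((hfre.mul hfre).add (hfim.mul hfim))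
  have hfp : f p = 0 := h.leviBilin_left_eq_zero hp hlam (hCR p hp)
  have hcxg : cx g = fun x => cx q x * levi ρ a a x - f x * conj (f x) := by
    funext x
    rw [Complex.mul_conj, ← congrFun h.cx_levi_re x]
    simp [cx, hgdef]
  have hreal : ∀ c : ℂ, (realField a c).act f p = 0 := by
    intro c
    have hnn := h.realField_act_act_re_nonneg hp hg
      (fun y hy => sub_nonneg.mpr (h.normSq_leviBilin_le hy (hCR y hy)))
      (by simp [hgdef, hlam, hfp]) c
    set X := realField a c with hX
    have hXM : InM1 a X := inM1_realField a c
    have hXs : X.Smooth := h.smooth_of_inM1 hXM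
    have hbar : X.bar = X := by
      simp [hX, CVF.bar, realField]
    have hXl : X.act (levi ρ a a) p = 0 :=
      h.act_levi_eq_zero hp hlam (h.tangent_of_inM1 hXM p hp)
    have hfirst : X.act (cx g) = fun x =>
        (X.act (cx q) x * levi ρ a a x + cx q x * X.act (levi ρ a a) x)
          - (X.act f x * conj (f x) + f x * conj (X.act f x)) := by
      funext x
      rw [hcxg, X.act_sub (hq.cx.mul hs) (hf.mul hf.star_comp), X.act_mul hq.cx hs,
        X.act_mul hf hf.star_comp, X.act_star hf, hbar]
    have s1 := hXs.act hq.cx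
    have s2 := hXs.act hs
    have s3 := hXs.act hf
    rw [hfirst, X.act_sub ((s1.mul hs).add (hq.cx.mul s2))
        ((s3.mul hf.star_comp).add (hf.mul s3.star_comp)), X.act_add (s1.mul hs) (hq.cx.mul s2),
      X.act_add (s3.mul hf.star_comp) (hf.mul s3.star_comp), X.act_mul s1 hs, X.act_mul hq.cx s2,
      X.act_mul s3 hf.star_comp, X.act_mul hf s3.star_comp, X.act_star hf, hbar, hlam, hXl, hfp,
      hflat X X hXM hXM] at hnn
    simp only [mul_zero, zero_mul, add_zero, zero_add, map_zero, zero_sub, Complex.mul_conj,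
      Complex.neg_re, Complex.add_re, Complex.ofReal_re] at hnn
    have := Complex.normSq_nonneg (X.act f p)
    exact Complex.normSq_eq_zero.mp (by linarith)
  have r1 := hreal 1
  have r2 := hreal Complex.I
  rw [realField_act] at r1 r2
  simp only [map_one, one_mul, Complex.conj_I] at r1 r2
  have r3 : (LVF a).act f p - (LbarVF a).act f p = 0 := by
    have : Complex.I * ((LVF a).act f p - (LbarVF a).act f p) = 0 := by rw [← r2]; ring
    exact (mul_eq_zero.mp this).resolve_left Complex.I_ne_zero
  obtain ⟨c₁, c₂, hc₁, hc₂, h₁, h₂⟩ := hV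
  rw [InM1.act_eq h₁ h₂]
  linear_combination (c₁ p + c₂ p) / 2 * r1 + (c₁ p - c₂ p) / 2 * r3

theorem exists_wz_ne_zero (h : IsPseudoconvexCR ρ a) (hp : ρ p = 0) :
    ∃ j, wz j (cx ρ) p ≠ 0 := by
  by_contra! H
  refine h.regular p hp (ContinuousLinearMap.ext fun v => ?_)
  have hz : ∀ j, fderiv ℝ ρ p (Pi.single j 1) = 0 ∧ fderiv ℝ ρ p (Pi.single j Complex.I) = 0 := by
    intro j
    have hj := H j
    rw [wz, fderiv_cx h.smooth, fderiv_cx h.smooth, div_eq_zero_iff] at hj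
    have hj := hj.resolve_right two_ne_zero
    have e1 := congrArg Complex.re hj
    have e2 := congrArg Complex.im hj
    simp at e1 e2
    exact ⟨e1, e2⟩
  have := clm_apply_eq_sum (fderiv ℝ (cx ρ) p) v
  simp only [fderiv_cx h.smooth, hz] at this
  simpa using this

theorem act_leviBilin_hol_eq_zero (h : IsPseudoconvexCR ρ a) {p : Cn n} (hp : ρ p = 0)
    (hlam : levi ρ a a p = 0)
    (hflat : ∀ V W, InM1 a V → InM1 a W → V.act (W.act (levi ρ a a)) p = 0)
    {G : CVF n} (hG : G.Smooth) (hGp : pairDRho ρ G p = 0)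
    {V : CVF n} (hV : InM1 a V) (hVG : V.act (pairDRho ρ G) p = 0) :
    V.act (fun x => leviBilin ρ x (fun j => G.hol j x) (fun j => conj (a j x))) p = 0 := by
  obtain ⟨j₀, hj₀⟩ := exists_wz_ne_zero h hp
  set r : Cn n → ℂ := wz j₀ (cx ρ) with hr
  have hrs : ContDiff ℝ (⊤ : ℕ∞) r := h.smooth.cx.wz j₀
  have hηs : ContDiff ℝ (⊤ : ℕ∞) (pairDRho ρ G) := hG.pairDRho h.smooth
  set ξ : Fin n → Cn n → ℂ := fun j x =>
    r x * G.hol j x - pairDRho ρ G x * (Pi.single j₀ 1 : Cn n) j with hξdef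
  have hξs : ∀ j, ContDiff ℝ (⊤ : ℕ∞) (ξ j) := fun j =>
    (hrs.mul (hG.1 j)).sub (hηs.mul contDiff_const)
  have hCR : ∀ x, ρ x = 0 → ∑ j, ξ j x * wz j (cx ρ) x = 0 := fun x _ => by
    simp only [hξdef, sub_mul, Finset.sum_sub_distrib, mul_assoc, ← Finset.mul_sum]
    simp [Pi.single_apply, pairDRho, hr, mul_comm]
  have hzero := h.act_leviBilin_eq_zero_of_CR hp hlam hflat hξs hCR hV
  set f : Cn n → ℂ := fun x => leviBilin ρ x (fun j => G.hol j x) (fun j => conj (a j x)) with hfdef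
  set e : Cn n → ℂ := fun x => leviBilin ρ x (Pi.single j₀ 1) (fun j => conj (a j x)) with hedef
  have hf : ContDiff ℝ (⊤ : ℕ∞) f :=
    h.smooth.leviBilin hG.1 fun j => (h.smooth_field j).star_comp
  have he : ContDiff ℝ (⊤ : ℕ∞) e :=
    h.smooth.leviBilin (ξ := fun j _ => (Pi.single j₀ 1 : Cn n) j) (fun j => contDiff_const)
      fun j => (h.smooth_field j).star_comp
  have hsplit : (fun x => leviBilin ρ x (fun j => ξ j x) (fun j => conj (a j x)))
      = fun x => r x * f x - pairDRho ρ G x * e x := by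
    funext x
    rw [show (fun j => ξ j x) = r x • (fun j => G.hol j x)
      - pairDRho ρ G x • (Pi.single j₀ 1 : Cn n) from rfl, leviBilin_sub_left,
      leviBilin_smul_left, leviBilin_smul_left]
  have hfp : f p = 0 := h.leviBilin_hol_eq_zero hp hlam hGp
  rw [hsplit, V.act_sub (hrs.mul hf) (hηs.mul he), V.act_mul hrs hf, V.act_mul hηs he, hfp, hGp,
    hVG] at hzero
  simp only [mul_zero, zero_mul, add_zero, zero_add, sub_zero] at hzero
  exact (mul_eq_zero.mp hzero).resolve_left hj₀

theorem act_leviBilin_anti_eq_zero (h : IsPseudoconvexCR ρ a) {p : Cn n} (hp : ρ p = 0)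
    (hlam : levi ρ a a p = 0)
    (hflat : ∀ V W, InM1 a V → InM1 a W → V.act (W.act (levi ρ a a)) p = 0)
    {G : CVF n} (hG : G.Smooth) (hGt : G.Tangent ρ) (hGp : pairDRho ρ G p = 0)
    {V : CVF n} (hV : InM1 a V) (hVG : V.act (pairDRho ρ G) p = 0) :
    V.act (fun x => leviBilin ρ x (fun j => a j x) (fun j => G.anti j x)) p = 0 := by
  have hstar : (fun x => leviBilin ρ x (fun j => a j x) (fun j => G.anti j x))
      = fun x => conj (leviBilin ρ x (fun j => G.bar.hol j x) (fun j => conj (a j x))) := by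
    funext x
    rw [star_leviBilin h.smooth]
    simp [CVF.bar]
  have hηs : ContDiff ℝ (⊤ : ℕ∞) (pairDRho ρ G) := hG.pairDRho h.smooth
  rw [hstar, CVF.act_star _ (h.smooth.leviBilin hG.bar.1 fun j => (h.smooth_field j).star_comp),
    h.act_leviBilin_hol_eq_zero hp hlam hflat hG.bar (by rw [h.pairDRho_bar_eq hp hGt, hGp]; simp)
      hV.bar, map_zero]
  rw [CVF.act_congr_of_eq h hp (h.tangent_of_inM1 hV.bar p hp) (hG.bar.pairDRho h.smooth)
    hηs.star_comp.neg fun y hy => h.pairDRho_bar_eq hy hGt, CVF.act_neg, CVF.act_star _ hηs]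
  simpa [CVF.bar] using hVG

end IsPseudoconvexCR

theorem ENat.sInf_mem_of_sInf_ne_top {s : Set ℕ∞} (hs : sInf s ≠ ⊤) : sInf s ∈ s :=
  csInf_mem (Set.nonempty_iff_ne_empty.mpr fun h => hs (by simp [h]))

namespace IsPseudoconvexCR

open ComplexConjugate

variable {n : ℕ} {ρ : Cn n → ℝ} {a : Fin n → Cn n → ℂ}

/-- If the Levi form on `L` is flat to second order, commutators of length four are in the kernel
of `∂ρ`. -/
theorem pairDRho_length_four_eq_zero (h : IsPseudoconvexCR ρ a) {p : Cn n} (hp : ρ p = 0)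
    (hlam : levi ρ a a p = 0)
    (hflat : ∀ V W, InM1 a V → InM1 a W → V.act (W.act (levi ρ a a)) p = 0) {G : CVF n}
    (hG : IsCommOf a 4 G) : pairDRho ρ G p = 0 := by
  cases hG with
  | succ V H hV hH =>
  have hHst := h.smooth_tangent_of_isCommOf hH
  rw [h.pairDRho_bracket_of_eq_zero hp hlam hV hHst.1 hHst.2
    (h.pairDRho_length_three_eq_zero hp hlam hH)]
  cases hH with
  | succ W G hW hG =>
  obtain ⟨hGs, hGt⟩ := h.smooth_tangent_of_isCommOf hG
  have hGp := h.pairDRho_length_two_eq_zero hp hlam hG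
  have hVp := h.tangent_of_inM1 hV p hp
  have hWp := h.tangent_of_inM1 hW p hp
  have hVG := h.act_pairDRho_length_two_eq_zero hp hlam hG hVp
  obtain ⟨c, hc, hcG⟩ := h.exists_pairDRho_length_two hG
  have hW' := hW
  have hWs := h.smooth_of_inM1 hW
  obtain ⟨c₁, c₂, hc₁, hc₂, h₁, h₂⟩ := hW'
  have hs := h.smooth_levi
  have hf₁ : ContDiff ℝ (⊤ : ℕ∞) fun x =>
      leviBilin ρ x (fun j => a j x) (fun j => G.anti j x) :=
    h.smooth.leviBilin h.smooth_field hGs.2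
  have hf₂ : ContDiff ℝ (⊤ : ℕ∞) fun x =>
      leviBilin ρ x (fun j => G.hol j x) (fun j => conj (a j x)) :=
    h.smooth.leviBilin hGs.1 fun j => (h.smooth_field j).star_comp
  have hWc := hWs.act hc
  have hWl := hWs.act hs
  have t1 := hWc.mul hs
  have t2 := hc.mul hWl
  have t3 := hc₁.mul hf₁
  have t4 := hc₂.mul hf₂
  rw [CVF.act_congr_of_eq h hp hVp (hHst.1.pairDRho h.smooth) (((t1.add t2).add t3).sub t4)
    fun y hy => ?_]
  · rw [V.act_sub ((t1.add t2).add t3) t4, V.act_add (t1.add t2) t3, V.act_add t1 t2,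
      V.act_mul hWc hs, V.act_mul hc hWl, V.act_mul hc₁ hf₁, V.act_mul hc₂ hf₂, hlam,
      h.act_levi_eq_zero hp hlam hVp, h.act_levi_eq_zero hp hlam hWp, hflat V W hV hW,
      h.act_leviBilin_anti_eq_zero hp hlam hflat hGs hGt hGp hV hVG,
      h.act_leviBilin_hol_eq_zero hp hlam hflat hGs hGp hV hVG,
      h.leviBilin_anti_eq_zero hp hlam hGt hGp, h.leviBilin_hol_eq_zero hp hlam hGp]
    ring
  · rw [h.pairDRho_bracket_inM1 hW h₁ h₂ hGs hGt hy,
      CVF.act_congr_of_eq h hy (h.tangent_of_inM1 hW y hy) (hGs.pairDRho h.smooth) (hc.mul hs) hcG,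
      W.act_mul hc hs]

theorem pairDRho_LVF_bracket_LbarVF (h : IsPseudoconvexCR ρ a) {x : Cn n} (hx : ρ x = 0) :
    pairDRho ρ ((LVF a).bracket (LbarVF a)) x = levi ρ a a x := by
  have hLb := inM1_LbarVF a
  rw [h.pairDRho_bracket_inM1 (inM1_LVF a) (c₁ := fun _ => 1) (c₂ := fun _ => 0)
    (by simp [LVF]) (by simp [LVF]) h.smooth_LbarVF (h.tangent_of_inM1 hLb) hx,
    CVF.act_eq_zero_of_eq_zero h hx (h.tangent_of_inM1 (inM1_LVF a) x hx)
      (h.smooth_LbarVF.pairDRho h.smooth) (fun y hy => h.pairDRho_of_inM1 hLb hy)]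
  simp [LbarVF, levi, leviBilin]

theorem LVF_bracket_LbarVF_hol (j : Fin n) (x : Cn n) :
    ((LVF a).bracket (LbarVF a)).hol j x = -(LbarVF a).act (a j) x := by
  simp only [CVF.bracket, LVF, LbarVF, CVF.act_const, zero_sub]

theorem LVF_bracket_LbarVF_anti (h : IsPseudoconvexCR ρ a) (j : Fin n) (x : Cn n) :
    ((LVF a).bracket (LbarVF a)).anti j x = conj ((LbarVF a).act (a j) x) := by
  rw [← LVF_bar, ← CVF.act_star _ (h.smooth_field j)]
  simp only [CVF.bracket, CVF.bar, LVF, map_zero, CVF.act_const, sub_zero]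

/-- The derivative along `L̄` of `λ(L, ζ̄)` for `ζ` the `(0,1)` part of `[L, L̄]`. -/
theorem LbarVF_act_leviBilin_bracket_anti (h : IsPseudoconvexCR ρ a) {p : Cn n} (hp : ρ p = 0)
    (hlam : levi ρ a a p = 0) :
    (LbarVF a).act (fun x => leviBilin ρ x (fun j => a j x)
        (fun j => ((LVF a).bracket (LbarVF a)).anti j x)) p
      = leviBilin ρ p (fun j => (LbarVF a).act (a j) p)
          (fun j => conj ((LbarVF a).act (a j) p)) := by
  set G := (LVF a).bracket (LbarVF a) with hGdef
  have hLs := h.smooth_LVF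
  have hLbs := h.smooth_LbarVF
  have hLbt := h.tangent_of_inM1 (inM1_LbarVF a)
  have hGs : G.Smooth := hLs.bracket hLbs
  have hGt : G.Tangent ρ :=
    CVF.Tangent.bracket h hLs hLbs (h.tangent_of_inM1 (inM1_LVF a)) hLbt
  have hGp : pairDRho ρ G p = 0 := (h.pairDRho_LVF_bracket_LbarVF hp).trans hlam
  set Z : CVF n := ⟨fun _ _ => 0, G.anti⟩ with hZdef
  have hZs : Z.Smooth := ⟨fun _ => contDiff_const, hGs.2⟩
  have hZρ : ∀ x, ρ x = 0 → Z.act (cx ρ) x = -levi ρ a a x := fun x hx => by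
    have : Z.act (cx ρ) x = ∑ j, G.anti j x * wzb j (cx ρ) x := by simp [CVF.act, hZdef]
    rw [this, ← pairDRho_bar h.smooth, h.pairDRho_bar_eq hx hGt,
      h.pairDRho_LVF_bracket_LbarVF hx, map_neg, Complex.conj_conj]
  have hZp : Z.act (cx ρ) p = 0 := by rw [hZρ p hp, hlam, neg_zero]
  have hleft : leviBilin ρ p (fun j => Z.act (a j) p) (fun j => conj (a j p)) = 0 := by
    refine h.leviBilin_left_eq_zero hp hlam ?_
    have hηL : Z.act (pairDRho ρ (LVF a)) p = 0 :=
      CVF.act_eq_zero_of_eq_zero h hp hZp (hLs.pairDRho h.smooth) h.tangent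
    have hηZ : pairDRho ρ Z = fun _ => 0 := by funext x; simp [pairDRho, hZdef]
    have key := pairDRho_bracket h.smooth hZs hLs p
    rw [hηL, hηZ, CVF.act_const] at key
    have e1 : leviBilin ρ p (fun j => (LVF a).hol j p) (fun j => Z.anti j p) = 0 :=
      h.leviBilin_anti_eq_zero (G := G) hp hlam hGt hGp
    rw [e1] at key
    have e2 : pairDRho ρ (Z.bracket (LVF a)) p = ∑ j, Z.act (a j) p * wz j (cx ρ) p := by
      simp only [pairDRho, CVF.bracket, hZdef, CVF.act_const, sub_zero]
      rfl
    rw [← e2, key]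
    simp [leviBilin, LVF]
  have hright : leviBilin ρ p (fun j => a j p)
      ((fun j => (LbarVF a).act (G.anti j) p) - fun j => Z.act (fun x => conj (a j x)) p) = 0 := by
    refine h.leviBilin_right_eq_zero hp hlam ?_
    have e1 : ((LbarVF a).bracket Z).act (cx ρ) p = 0 := by
      rw [CVF.act_bracket hLbs hZs h.smooth.cx,
        CVF.act_eq_zero_of_eq_zero h hp hZp (hLbs.act h.smooth.cx) hLbt,
        CVF.act_congr_of_eq h hp (hLbt p hp) (hZs.act h.smooth.cx) h.smooth_levi.neg hZρ,
        CVF.act_neg, h.act_levi_eq_zero hp hlam (hLbt p hp)]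
      simp
    rw [← e1]
    simp only [CVF.act, CVF.bracket, hZdef, LbarVF, Pi.sub_apply]
    simp [wzb]
  have hZlam := h.act_levi_eq_zero hp hlam hZp
  rw [show levi ρ a a = fun x => leviBilin ρ x (fun j => a j x) (fun j => conj (a j x)) from rfl,
    Z.act_leviBilin h.smooth h.smooth_field fun j => (h.smooth_field j).star_comp, hleft] at hZlam
  rw [leviBilin_sub_right] at hright
  have hthird : ∑ j, ∑ l, (LbarVF a).act (leviCoeff ρ j l) p * a j p * G.anti l p
      = ∑ j, ∑ l, Z.act (leviCoeff ρ j l) p * a j p * conj (a l p) := by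
    refine Finset.sum_congr rfl fun j _ => ?_
    simp only [CVF.act, hZdef, LbarVF, zero_mul, Finset.sum_const_zero, zero_add, Finset.sum_mul]
    rw [Finset.sum_comm]
    refine Finset.sum_congr rfl fun l _ => Finset.sum_congr rfl fun k _ => ?_
    rw [wzb_leviCoeff_comm h.smooth]
    ring
  have hmid : (fun j => G.anti j p) = fun j => conj ((LbarVF a).act (a j) p) :=
    funext fun j => h.LVF_bracket_LbarVF_anti j p
  rw [CVF.act_leviBilin _ h.smooth h.smooth_field hGs.2, hthird, hmid]
  linear_combination hZlam + hright

/-- The commutator `[L̄, [L, [L, L̄]]]` at a point where the Levi form vanishes on `L`. -/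
theorem pairDRho_bracket_bracket_bracket (h : IsPseudoconvexCR ρ a) {p : Cn n} (hp : ρ p = 0)
    (hlam : levi ρ a a p = 0) :
    pairDRho ρ ((LbarVF a).bracket ((LVF a).bracket ((LVF a).bracket (LbarVF a)))) p
      = (LbarVF a).act ((LVF a).act (levi ρ a a)) p
        + leviBilin ρ p (fun j => (LbarVF a).act (a j) p)
          (fun j => conj ((LbarVF a).act (a j) p)) := by
  have hL := inM1_LVF a
  have hLb := inM1_LbarVF a
  have hG : IsCommOf a 2 ((LVF a).bracket (LbarVF a)) := .succ _ _ hL (.one _ hLb)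
  have hH : IsCommOf a 3 ((LVF a).bracket ((LVF a).bracket (LbarVF a))) := .succ _ _ hL hG
  obtain ⟨hGs, hGt⟩ := h.smooth_tangent_of_isCommOf hG
  obtain ⟨hHs, hHt⟩ := h.smooth_tangent_of_isCommOf hH
  have hf := h.smooth.leviBilin h.smooth_field hGs.2
  have hLl := h.smooth_LVF.act h.smooth_levi
  rw [h.pairDRho_bracket_of_eq_zero hp hlam hLb hHs hHt
      (h.pairDRho_length_three_eq_zero hp hlam hH),
    ← h.LbarVF_act_leviBilin_bracket_anti hp hlam, ← CVF.act_add _ hLl hf]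
  refine CVF.act_congr_of_eq h hp (h.tangent_of_inM1 hLb p hp) (hHs.pairDRho h.smooth)
    (hLl.add hf) fun y hy => ?_
  rw [h.pairDRho_bracket_inM1 hL (c₁ := fun _ => 1) (c₂ := fun _ => 0) (by simp [LVF])
    (by simp [LVF]) hGs hGt hy, CVF.act_congr_of_eq h hy (h.tangent_of_inM1 hL y hy)
    (hGs.pairDRho h.smooth) h.smooth_levi fun z hz => h.pairDRho_LVF_bracket_LbarVF hz]
  ring

theorem exists_pairDRho_length_four_ne_zero (h : IsPseudoconvexCR ρ a) {p : Cn n} (hp : ρ p = 0)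
    (hlam : levi ρ a a p = 0)
    (hpos : 0 < ((LbarVF a).act ((LVF a).act (levi ρ a a)) p).re) :
    ∃ G, IsCommOf a 4 G ∧ pairDRho ρ G p ≠ 0 := by
  have hL := inM1_LVF a
  have hLb := inM1_LbarVF a
  refine ⟨_, .succ _ _ hLb (.succ _ _ hL (.succ _ _ hL (.one _ hLb))), fun hzero => ?_⟩
  have hCR : ∑ j, (LbarVF a).act (a j) p * wz j (cx ρ) p = 0 := by
    have := (h.pairDRho_LVF_bracket_LbarVF hp).trans hlam
    simpa [pairDRho, LVF_bracket_LbarVF_hol] using this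
  have hnn := h.levi_nonneg p hp _ hCR
  rw [h.pairDRho_bracket_bracket_bracket hp hlam] at hzero
  have := congrArg Complex.re hzero
  rw [Complex.add_re, Complex.zero_re] at this
  linarith

/-- The Levi form on `L` vanishes to order exactly two, witnessed by `L̄ L λ(L,L)`. -/
theorem nuL_levi_eq_two_iff (h : IsPseudoconvexCR ρ a) {p : Cn n} (hp : ρ p = 0) :
    nuL a (levi ρ a a) p = 2 ↔
      levi ρ a a p = 0 ∧ 0 < ((LbarVF a).act ((LVF a).act (levi ρ a a)) p).re := by
  constructor
  · intro hν
    have hlam : levi ρ a a p = 0 := by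
      by_contra hne
      have : nuL a (levi ρ a a) p ≤ 0 := sInf_le ⟨[], by simp, by simp, hne⟩
      simp [hν] at this
    refine ⟨hlam, (h.second_order_dichotomy hp hlam).resolve_left fun hflat => ?_⟩
    obtain ⟨Ws, hlen, hWs, hne⟩ := ENat.sInf_mem_of_sInf_ne_top (hν.trans_ne (by simp))
    rw [show sInf _ = (2 : ℕ∞) from hν] at hlen
    obtain ⟨W₁, W₂, rfl⟩ := List.length_eq_two.mp (by exact_mod_cast hlen)
    exact hne (hflat W₂ W₁ (hWs W₂ (by simp)) (hWs W₁ (by simp)))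
  · rintro ⟨hlam, hpos⟩
    refine le_antisymm (sInf_le ⟨[LVF a, LbarVF a], by simp, ?_, fun hzero => ?_⟩) (le_sInf ?_)
    · simp [inM1_LVF, inM1_LbarVF]
    · rw [show ((LbarVF a).act ((LVF a).act (levi ρ a a)) p) = 0 from hzero] at hpos
      simp at hpos
    · rintro _ ⟨Ws, rfl, hWs, hne⟩
      match Ws, hWs, hne with
      | [], _, hne => exact absurd hlam hne
      | [W], hWs, hne =>
        exact absurd (h.act_levi_eq_zero hp hlam (h.tangent_of_inM1 (hWs W (by simp)) p hp)) hne
      | _ :: _ :: _, _, _ => simp; norm_cast; omega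

theorem tType_eq_four_iff (h : IsPseudoconvexCR ρ a) {p : Cn n} (hp : ρ p = 0) :
    tType ρ a p = 4 ↔
      levi ρ a a p = 0 ∧ 0 < ((LbarVF a).act ((LVF a).act (levi ρ a a)) p).re := by
  constructor
  · intro ht
    have hlam : levi ρ a a p = 0 := by
      by_contra hne
      have : tType ρ a p ≤ 2 := sInf_le ⟨2, rfl, _,
        .succ _ _ (inM1_LVF a) (.one _ (inM1_LbarVF a)),
        (h.pairDRho_LVF_bracket_LbarVF hp).trans_ne hne⟩
      rw [ht] at this
      exact absurd this (by decide)
    refine ⟨hlam, (h.second_order_dichotomy hp hlam).resolve_left fun hflat => ?_⟩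
    obtain ⟨k, hk, G, hG, hne⟩ := ENat.sInf_mem_of_sInf_ne_top (ht.trans_ne (by simp))
    rw [show sInf _ = (4 : ℕ∞) from ht] at hk
    obtain rfl : k = 4 := by exact_mod_cast hk
    exact hne (h.pairDRho_length_four_eq_zero hp hlam hflat hG)
  · rintro ⟨hlam, hpos⟩
    refine le_antisymm (sInf_le ⟨4, rfl, h.exists_pairDRho_length_four_ne_zero hp hlam hpos⟩)
      (le_sInf ?_)
    rintro _ ⟨k, rfl, G, hG, hne⟩
    match k, hG with
    | 0, hG => cases hG
    | 1, hG =>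
      cases hG with
      | one _ hG => exact absurd (h.pairDRho_of_inM1 hG hp) hne
      | succ _ _ _ hW => cases hW
    | 2, hG => exact absurd (h.pairDRho_length_two_eq_zero hp hlam hG) hne
    | 3, hG => exact absurd (h.pairDRho_length_three_eq_zero hp hlam hG) hne
    | k + 4, _ => exact_mod_cast Nat.le_add_left 4 k

theorem cType_eq_four_iff_tType_eq_four (h : IsPseudoconvexCR ρ a) {p : Cn n} (hp : ρ p = 0)
    : cType ρ a p = 4 ↔ tType ρ a p = 4 := by
  rw [h.tType_eq_four_iff hp, ← h.nuL_levi_eq_two_iff hp, cType]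
  cases hν : nuL a (levi ρ a a) p with
  | top => simp
  | coe k => norm_cast; omega

end IsPseudoconvexCR

/-- D'Angelo. For a smooth pseudoconvex real hypersurface `M ⊂ ℂⁿ`,
`p ∈ M`, and a smooth CR vector field `L` along `M` with `L(p) ≠ 0`: if either
`c_L(M,p) = 4` or `t_L(M,p) = 4`, then both equal `4`. -/
theorem type_four {n : ℕ} (hn : 2 ≤ n) (ρ : Cn n → ℝ) (hρ : ContDiff ℝ (⊤ : ℕ∞) ρ)
    (M : Set (Cn n)) (hM : M = {x | ρ x = 0}) (hreg : ∀ x ∈ M, fderiv ℝ ρ x ≠ 0)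
    (hpsc : Pseudoconvex ρ M)
    (p : Cn n) (hp : p ∈ M)
    (a : Fin n → Cn n → ℂ) (ha : IsCRField ρ M a) (hap : (fun j => a j p) ≠ 0)
    (h4 : cType ρ a p = 4 ∨ tType ρ a p = 4) :
    cType ρ a p = 4 ∧ tType ρ a p = 4 := by
  subst hM
  have h : IsPseudoconvexCR ρ a := ⟨hρ, hreg, hpsc, ha.1, ha.2⟩
  rw [h.cType_eq_four_iff_tType_eq_four hp] at h4 ⊢
  simpa using h4
end

section
/- Let M = {(z₁,z₂,w) ∈ ℂ³ : ρ = 0} where ρ = 2Re(w) + (z₂ + z̄₂ + |z₁|²)², and let p = 0. Then: (i) every nonsingular holomorphic curve through 0 has order of contact at most 4 with M at 0, and the curve ξ ↦ (ξ,0,0) has order of contact exactly 4, so a^{(1)}(M,0) = 4; (ii) for the nowhere-vanishing CR vector field L = ∂/∂z₁ − z̄₁ ∂/∂z₂ one has t_L(M,0) = ∞ and c_L(M,0) = ∞, hence t^{(1)}(M,0) = c^{(1)}(M,0) = ∞. -/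
open Topology

/-- The vanishing order at `0` of a smooth function on a normed space: the smallest `k`
with `iteratedFDeriv ℝ k g 0 ≠ 0` (`⊤` if none). -/
noncomputable def ordAt {E : Type*} [NormedAddCommGroup E] [NormedSpace ℝ E]
    (g : E → ℝ) : ℕ∞ :=
  sInf {m : ℕ∞ | ∃ k : ℕ, (k : ℕ∞) = m ∧ iteratedFDeriv ℝ k g 0 ≠ 0}

/-- `t^{(1)}(M,p)`: supremum of the commutator types `t_L(M,p)` over smooth CR vector
fields `L` along `M` near `p` that vanish nowhere near `p`. -/
noncomputable def tOne {n : ℕ} (ρ : Cn n → ℝ) (M : Set (Cn n)) (p : Cn n) : ℕ∞ :=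
  sSup {t : ℕ∞ | ∃ a : Fin n → Cn n → ℂ, (∀ j, ContDiff ℝ (⊤ : ℕ∞) (a j)) ∧
    (∀ᶠ x in nhds p, x ∈ M → ∑ j, a j x * wz j (cx ρ) x = 0) ∧
    (∀ᶠ x in nhds p, (fun j => a j x) ≠ 0) ∧ t = tType ρ a p}

/-- `c^{(1)}(M,p)`: supremum of the Levi-form types `c_L(M,p)` over smooth CR vector
fields `L` along `M` near `p` that vanish nowhere near `p`. -/
noncomputable def cOne {n : ℕ} (ρ : Cn n → ℝ) (M : Set (Cn n)) (p : Cn n) : ℕ∞ :=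
  sSup {t : ℕ∞ | ∃ a : Fin n → Cn n → ℂ, (∀ j, ContDiff ℝ (⊤ : ℕ∞) (a j)) ∧
    (∀ᶠ x in nhds p, x ∈ M → ∑ j, a j x * wz j (cx ρ) x = 0) ∧
    (∀ᶠ x in nhds p, (fun j => a j x) ≠ 0) ∧ t = cType ρ a p}

/-- `a^{(1)}(M,p)`: supremum over nonsingular holomorphic curves `φ` through `p`
(`φ(0) = p`, `φ′(0) ≠ 0`) of the order of contact of `φ` with `M` at `p`, i.e. of the
vanishing order of `ρ ∘ φ` at `0`. -/
noncomputable def aOne {n : ℕ} (ρ : Cn n → ℝ) (p : Cn n) : ℕ∞ :=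
  sSup {t : ℕ∞ | ∃ φ : ℂ → Cn n, AnalyticAt ℂ φ 0 ∧ φ 0 = p ∧ fderiv ℂ φ 0 ≠ 0 ∧
    t = ordAt (fun ξ => ρ (φ ξ))}

/-- Bloom's example: `ρ = 2Re(w) + (z₂ + z̄₂ + |z₁|²)²` on ℂ³, coordinates
`(z₁, z₂, w) = (z 0, z 1, z 2)`. -/
noncomputable def bloomRho : Cn 3 → ℝ :=
  fun z => 2 * (z 2).re + (2 * (z 1).re + Complex.normSq (z 0)) ^ 2

/-- The CR vector field `L = ∂/∂z₁ − z̄₁ ∂/∂z₂` of Bloom's example. -/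
noncomputable def bloomL : Fin 3 → Cn 3 → ℂ :=
  ![fun _ => 1, fun z => -(starRingEnd ℂ (z 0)), fun _ => 0]

open Asymptotics Filter in
/-- Averaging an analytic function over the rotations by the `n`-th roots of unity kills all
Taylor coefficients of positive degree below `n`. -/
lemma AnalyticAt.sum_rotations_isBigO {f : ℂ → ℂ} (hf : AnalyticAt ℂ f 0) (h0 : f 0 = 0)
    {n : ℕ} {ζ : ℂ} (hζ : IsPrimitiveRoot ζ n) (hn : n ≠ 0) :
    (fun z => ∑ k ∈ Finset.range n, f (ζ ^ k * z)) =O[𝓝 0] fun z => ‖z‖ ^ n := by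
  obtain ⟨p, hp⟩ := hf
  have hrem : (fun z => ∑ k ∈ Finset.range n, (f (ζ ^ k * z) - p.partialSum n (ζ ^ k * z)))
      =O[𝓝 0] fun z => ‖z‖ ^ n := by
    refine IsBigO.fun_sum fun k _ => ?_
    have ht : Tendsto (fun z : ℂ => ζ ^ k * z) (𝓝 0) (𝓝 0) :=
      Continuous.tendsto' (by fun_prop) _ _ (by simp)
    simpa [Function.comp_def, hζ.norm'_eq_one hn] using
      (hp.isBigO_sub_partialSum_pow n).comp_tendsto ht
  refine hrem.congr_left fun z => ?_
  rw [Finset.sum_sub_distrib, sub_eq_self]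
  simp only [FormalMultilinearSeries.partialSum, FormalMultilinearSeries.apply_eq_pow_smul_coeff]
  rw [Finset.sum_comm]
  refine Finset.sum_eq_zero fun i hi => ?_
  rcases Nat.eq_zero_or_pos i with rfl | hi0
  · have hc : p.coeff 0 = 0 := by
      rw [FormalMultilinearSeries.coeff, hp.coeff_zero, h0]
    simp [hc]
  · have hgeom : ∑ k ∈ Finset.range n, (ζ ^ i) ^ k = 0 := by
      have h1 : ζ ^ i ≠ 1 := hζ.pow_ne_one_of_pos_of_lt hi0.ne' (Finset.mem_range.1 hi)
      rw [geom_sum_eq h1, ← pow_mul, mul_comm i n, pow_mul, hζ.pow_eq_one]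
      simp
    calc ∑ k ∈ Finset.range n, (ζ ^ k * z) ^ i • p.coeff i
        = (∑ k ∈ Finset.range n, (ζ ^ i) ^ k) * (z ^ i * p.coeff i) := by
          rw [Finset.sum_mul]
          refine Finset.sum_congr rfl fun k _ => ?_
          rw [smul_eq_mul, mul_pow, ← pow_mul, ← pow_mul, mul_comm k i, mul_assoc]
      _ = 0 := by rw [hgeom, zero_mul]

open Asymptotics Filter in
lemma sum_rotations_isLittleO {u : ℂ → ℝ} {m n : ℕ} {ζ : ℂ} (hζ : ‖ζ‖ = 1)
    (hu : u =o[𝓝 0] fun z => ‖z‖ ^ m) :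
    (fun z => ∑ k ∈ Finset.range n, u (ζ ^ k * z)) =o[𝓝 0] fun z => ‖z‖ ^ m := by
  refine IsLittleO.fun_sum fun k _ => ?_
  have ht : Tendsto (fun z : ℂ => ζ ^ k * z) (𝓝 0) (𝓝 0) :=
    Continuous.tendsto' (by fun_prop) _ _ (by simp)
  simpa [Function.comp_def, hζ] using hu.comp_tendsto ht

open Asymptotics in
lemma isLittleO_of_sum_rotations {u : ℂ → ℝ} (hu0 : ∀ z, 0 ≤ u z) {m n : ℕ} (hn : n ≠ 0) {ζ : ℂ}
    (hu : (fun z => ∑ k ∈ Finset.range n, u (ζ ^ k * z)) =o[𝓝 0] fun z => ‖z‖ ^ m) :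
    u =o[𝓝 0] fun z => ‖z‖ ^ m := by
  refine IsBigO.trans_isLittleO (IsBigO.of_norm_le fun z => ?_) hu
  rw [Real.norm_of_nonneg (hu0 z)]
  simpa using Finset.single_le_sum (f := fun k => u (ζ ^ k * z)) (fun k _ => hu0 _)
    (Finset.mem_range.2 (Nat.pos_of_ne_zero hn))

open Asymptotics in
/-- A holomorphic function whose real part vanishes to order greater than one at `0` has
vanishing derivative there. -/
lemma deriv_eq_zero_of_re_isLittleO {f : ℂ → ℂ} (hf : DifferentiableAt ℂ f 0) (h0 : f 0 = 0)
    (hre : (fun z => (f z).re) =o[𝓝 0] fun z => ‖z‖) : deriv f 0 = 0 := by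
  have h1 := Complex.reCLM.hasFDerivAt.comp (0 : ℂ)
    (hf.hasDerivAt.hasFDerivAt.restrictScalars ℝ)
  have h2 : HasFDerivAt (Complex.reCLM ∘ f) (0 : ℂ →L[ℝ] ℝ) 0 := by
    rw [hasFDerivAt_iff_isLittleO_nhds_zero]
    simpa [h0] using hre.of_norm_right
  have h3 := DFunLike.congr_fun (h1.unique h2) (starRingEnd ℂ (deriv f 0))
  refine Complex.normSq_eq_zero.1 ?_
  simpa [Complex.normSq_apply] using h3

open Asymptotics in
/-- A real-analytic function whose order at `0` exceeds `n` is `o(‖z‖ ^ n)`. -/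
lemma isLittleO_pow_of_lt_ordAt {E : Type*} [NormedAddCommGroup E] [NormedSpace ℝ E] {g : E → ℝ}
    (hg : AnalyticAt ℝ g 0) {n : ℕ} (hn : (n : ℕ∞) < ordAt g) :
    g =o[𝓝 0] fun z => ‖z‖ ^ n := by
  have hD : ∀ k ≤ n, iteratedFDeriv ℝ k g 0 = 0 := by
    intro k hk
    by_contra hne
    exact absurd (hn.trans_le (sInf_le ⟨k, rfl, hne⟩)) (by simpa using hk)
  obtain ⟨p, r, hp⟩ := hg
  have hps : ∀ y, p.partialSum (n + 1) y = 0 := by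
    intro y
    refine Finset.sum_eq_zero fun k hk => ?_
    have := hp.factorial_smul y k
    rw [hD k (Nat.lt_succ_iff.1 (Finset.mem_range.1 hk))] at this
    simpa [Nat.factorial_ne_zero] using this
  have hO : g =O[𝓝 0] fun z => ‖z‖ ^ (n + 1) := by
    simpa [hps] using hp.hasFPowerSeriesAt.isBigO_sub_partialSum_pow (n + 1)
  exact hO.trans_isLittleO ((isLittleO_pow_pow n.lt_succ_self).comp_tendsto tendsto_norm_zero)

/-- Common form of the two Wirtinger derivatives: `c = -I` gives `wz`, `c = I` gives `wzb`. -/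
noncomputable def wirtinger {n : ℕ} (c : ℂ) (j : Fin n) (f : Cn n → ℂ) (x : Cn n) : ℂ :=
  (fderiv ℝ f x (Pi.single j 1) + c * fderiv ℝ f x (Pi.single j Complex.I)) / 2

lemma wz_eq_wirtinger {n : ℕ} : @wz n = wirtinger (-Complex.I) := by
  ext j f x
  simp [wz, wirtinger, sub_eq_add_neg]

lemma wzb_eq_wirtinger {n : ℕ} : @wzb n = wirtinger Complex.I := rfl

section wirtinger

variable {n : ℕ} {c : ℂ} {j : Fin n} {f g : Cn n → ℂ} {x : Cn n}

lemma wirtinger_const (a : ℂ) : wirtinger c j (fun _ => a) x = 0 := by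
  simp [wirtinger]

lemma wirtinger_add (hf : DifferentiableAt ℝ f x) (hg : DifferentiableAt ℝ g x) :
    wirtinger c j (fun y => f y + g y) x = wirtinger c j f x + wirtinger c j g x := by
  simp only [wirtinger, fderiv_fun_add hf hg, add_apply]
  ring

lemma wirtinger_mul (hf : DifferentiableAt ℝ f x) (hg : DifferentiableAt ℝ g x) :
    wirtinger c j (fun y => f y * g y) x =
      f x * wirtinger c j g x + g x * wirtinger c j f x := by
  simp only [wirtinger, fderiv_fun_mul hf hg, add_apply, smul_apply, smul_eq_mul]
  ring

lemma wirtinger_coord (k : Fin n) :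
    wirtinger c j (fun y => y k) x = if k = j then (1 + c * Complex.I) / 2 else 0 := by
  have h : fderiv ℝ (fun y : Cn n => y k) x = ContinuousLinearMap.proj k :=
    (ContinuousLinearMap.proj (R := ℝ) (φ := fun _ : Fin n => ℂ) k).fderiv
  simp only [wirtinger, h, ContinuousLinearMap.proj_apply, Pi.single_apply]
  split_ifs <;> simp

lemma wirtinger_conj_coord (k : Fin n) :
    wirtinger c j (fun y => starRingEnd ℂ (y k)) x =
      if k = j then (1 - c * Complex.I) / 2 else 0 := by
  have h : fderiv ℝ (fun y : Cn n => starRingEnd ℂ (y k)) x =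
      Complex.conjCLE.toContinuousLinearMap.comp (ContinuousLinearMap.proj k) :=
    (Complex.conjCLE.toContinuousLinearMap.comp
      (ContinuousLinearMap.proj (R := ℝ) (φ := fun _ : Fin n => ℂ) k)).fderiv
  simp only [wirtinger, h, ContinuousLinearMap.comp_apply, ContinuousLinearMap.proj_apply,
    Pi.single_apply]
  split_ifs <;> simp [sub_eq_add_neg]

lemma differentiableAt_conj_coord (k : Fin n) :
    DifferentiableAt ℝ (fun y : Cn n => starRingEnd ℂ (y k)) x :=
  (Complex.conjCLE.toContinuousLinearMap.comp
      (ContinuousLinearMap.proj (R := ℝ) (φ := fun _ : Fin n => ℂ) k)).differentiableAt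

end wirtinger

/-- The function `z₂ + z̄₂ + |z₁|²` whose square appears in Bloom's example. -/
noncomputable def bloomS (z : Cn 3) : ℂ :=
  z 1 + starRingEnd ℂ (z 1) + z 0 * starRingEnd ℂ (z 0)

lemma differentiableAt_bloomS (x : Cn 3) : DifferentiableAt ℝ bloomS x := by
  have h := fun k : Fin 3 => differentiableAt_conj_coord (x := x) k
  exact ((by fun_prop : DifferentiableAt ℝ (fun z : Cn 3 => z 1) x).add (h 1)).add
    ((by fun_prop : DifferentiableAt ℝ (fun z : Cn 3 => z 0) x).mul (h 0))

lemma wirtinger_bloomS (c : ℂ) (j : Fin 3) (x : Cn 3) :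
    wirtinger c j bloomS x =
      ![(x 0 * (1 - c * Complex.I) + starRingEnd ℂ (x 0) * (1 + c * Complex.I)) / 2, 1, 0] j := by
  have h := fun k : Fin 3 => differentiableAt_conj_coord (x := x) k
  have h' : ∀ k : Fin 3, DifferentiableAt ℝ (fun z : Cn 3 => z k) x := fun k => by fun_prop
  unfold bloomS
  rw [wirtinger_add ((h' 1).fun_add (h 1)) ((h' 0).fun_mul (h 0)), wirtinger_add (h' 1) (h 1),
    wirtinger_mul (h' 0) (h 0)]
  simp only [wirtinger_coord, wirtinger_conj_coord]
  fin_cases j <;> simp <;> ring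

lemma wirtinger_two_mul_bloomS (c : ℂ) (j : Fin 3) (x : Cn 3) :
    wirtinger c j (fun x => 2 * bloomS x) x = 2 * wirtinger c j bloomS x := by
  rw [wirtinger_mul (by fun_prop) (differentiableAt_bloomS x), wirtinger_const]
  ring

lemma cx_bloomRho :
    cx bloomRho = fun z => z 2 + starRingEnd ℂ (z 2) + bloomS z * bloomS z := by
  ext z
  simp only [cx, bloomRho, bloomS, Complex.add_conj, Complex.mul_conj]
  push_cast
  ring

lemma wirtinger_bloomRho (c : ℂ) (j : Fin 3) (x : Cn 3) :
    wirtinger c j (cx bloomRho) x =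
      (if j = 2 then 1 else 0) + 2 * bloomS x * wirtinger c j bloomS x := by
  have h := differentiableAt_conj_coord (x := x) (2 : Fin 3)
  have h' : DifferentiableAt ℝ (fun z : Cn 3 => z 2) x := by fun_prop
  have hS := differentiableAt_bloomS x
  rw [cx_bloomRho, wirtinger_add (h'.fun_add h) (hS.fun_mul hS), wirtinger_add h' h,
    wirtinger_mul hS hS, wirtinger_coord, wirtinger_conj_coord]
  simp only [eq_comm (a := (2 : Fin 3))]
  split_ifs <;> ring

lemma bloomL_tangent (z : Cn 3) : ∑ j, bloomL j z * wz j (cx bloomRho) z = 0 := by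
  simp only [wz_eq_wirtinger, wirtinger_bloomRho, wirtinger_bloomS, Fin.sum_univ_three, bloomL]
  simp
  ring

lemma levi_bloom : levi bloomRho bloomL bloomL = fun x => 2 * bloomS x := by
  have hb : ∀ l : Fin 3, wzb l (cx bloomRho) =
      fun x => ![2 * bloomS x * x 0, 2 * bloomS x, 1] l := by
    intro l
    ext x
    simp only [wzb_eq_wirtinger, wirtinger_bloomRho, wirtinger_bloomS]
    fin_cases l <;> simp
    ring_nf
    simp
  ext x
  have hS := differentiableAt_bloomS x
  have h3 : ∀ j : Fin 3, wirtinger (-Complex.I) j (fun x => 2 * bloomS x * x 0) x =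
      2 * bloomS x * wirtinger (-Complex.I) j (fun x => x 0) x +
        x 0 * (2 * wirtinger (-Complex.I) j bloomS x) := by
    intro j
    rw [wirtinger_mul (by fun_prop) (by fun_prop), wirtinger_two_mul_bloomS]
  simp only [levi, leviCoeff, hb, wz_eq_wirtinger, Fin.sum_univ_three, bloomL]
  simp [wirtinger_two_mul_bloomS, h3, wirtinger_const, wirtinger_bloomS, wirtinger_coord]
  ring

lemma act_levi_bloom {W : CVF 3} (hW : InM1 bloomL W) :
    W.act (levi bloomRho bloomL bloomL) = 0 := by
  obtain ⟨c₁, c₂, -, -, h₁, h₂⟩ := hW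
  ext x
  rw [levi_bloom]
  simp only [CVF.act, wz_eq_wirtinger, wzb_eq_wirtinger, wirtinger_two_mul_bloomS,
    wirtinger_bloomS, h₁, h₂, Fin.sum_univ_three, bloomL]
  simp
  ring

lemma act_zero {n : ℕ} (W : CVF n) : W.act 0 = 0 := by
  ext x
  simp [CVF.act, wz, wzb]

lemma foldl_act_zero {n : ℕ} (Ws : List (CVF n)) :
    Ws.foldl (fun g W => W.act g) (0 : Cn n → ℂ) = 0 := by
  induction Ws with
  | nil => rfl
  | cons W Ws ih => rw [List.foldl_cons, act_zero, ih]

lemma cType_bloom : cType bloomRho bloomL 0 = ⊤ := by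
  have : nuL bloomL (levi bloomRho bloomL bloomL) 0 = ⊤ := by
    refine sInf_eq_top.2 ?_
    rintro m ⟨Ws, -, hWs, hne⟩
    refine absurd ?_ hne
    cases Ws with
    | nil => simp [levi_bloom, bloomS]
    | cons W Ws =>
      rw [List.foldl_cons, act_levi_bloom (hWs W (by simp)), foldl_act_zero, Pi.zero_apply]
  simp [cType, this]

lemma IsCommOf.hol_two_eq_zero {μ : ℕ} {G : CVF 3} (hG : IsCommOf bloomL μ G) :
    G.hol 2 = 0 := by
  have hM : ∀ W : CVF 3, InM1 bloomL W → W.hol 2 = 0 := by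
    rintro W ⟨c₁, -, -, -, h, -⟩
    ext x
    simp [h, bloomL]
  induction hG with
  | one W hW => exact hM W hW
  | succ V W hV _ ih =>
    ext x
    simp [CVF.bracket, ih, hM V hV, act_zero]

lemma tType_bloom : tType bloomRho bloomL 0 = ⊤ := by
  refine sInf_eq_top.2 ?_
  rintro m ⟨μ, -, G, hG, hne⟩
  refine absurd ?_ hne
  simp [pairDRho, wz_eq_wirtinger, wirtinger_bloomRho, hG.hol_two_eq_zero,
    bloomS]

lemma bloomL_ne_zero (z : Cn 3) : (fun j => bloomL j z) ≠ 0 := fun h => by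
  simpa [bloomL] using congrFun h 0

lemma contDiff_bloomL (j : Fin 3) : ContDiff ℝ (⊤ : ℕ∞) (bloomL j) := by
  fin_cases j
  · exact contDiff_const
  · exact (Complex.conjCLE.contDiff.comp
      (contDiff_apply ℝ ℂ (0 : Fin 3))).neg
  · exact contDiff_const

open Asymptotics in
/-- Bloom's hypersurface contains no nonsingular holomorphic curve to order greater than four. -/
lemma ordAt_bloom_le {φ : ℂ → Cn 3} (hφ : AnalyticAt ℂ φ 0) (h0 : φ 0 = 0)
    (hφ' : fderiv ℂ φ 0 ≠ 0) : ordAt (fun ξ => bloomRho (φ ξ)) ≤ 4 := by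
  by_contra! hlt
  have hcomp : ∀ j, AnalyticAt ℂ (fun ξ => φ ξ j) 0 := analyticAt_pi_iff.1 hφ
  have hcomp0 : ∀ j, φ 0 j = 0 := fun j => by rw [h0]; rfl
  have hre : ∀ j, AnalyticAt ℝ (fun ξ => (φ ξ j).re) 0 := fun j =>
    (Complex.reCLM.analyticAt _).comp (hcomp j).restrictScalars
  have him : ∀ j, AnalyticAt ℝ (fun ξ => (φ ξ j).im) 0 := fun j =>
    (Complex.imCLM.analyticAt _).comp (hcomp j).restrictScalars
  set h : ℂ → ℝ := fun ξ => 2 * (φ ξ 1).re + Complex.normSq (φ ξ 0) with hh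
  have hg : AnalyticAt ℝ (fun ξ => bloomRho (φ ξ)) 0 := by
    have hr0 := hre 0
    have hr1 := hre 1
    have hr2 := hre 2
    have hi0 := him 0
    simp only [bloomRho, Complex.normSq_apply]
    fun_prop
  have hgo : (fun ξ => 2 * (φ ξ 2).re + h ξ ^ 2) =o[𝓝 0] fun ξ => ‖ξ‖ ^ 4 :=
    isLittleO_pow_of_lt_ordAt hg (n := 4) (by exact_mod_cast hlt)
  obtain ⟨ζ, hζ⟩ : ∃ ζ : ℂ, IsPrimitiveRoot ζ 5 := ⟨_, Complex.isPrimitiveRoot_exp 5 (by simp)⟩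
  have hζ1 : ‖ζ‖ = 1 := hζ.norm'_eq_one (by simp)
  have hsum : ∀ (j : Fin 3) (m : ℕ), m < 5 →
      (fun ξ => ∑ k ∈ Finset.range 5, 2 * (φ (ζ ^ k * ξ) j).re) =o[𝓝 0] fun ξ => ‖ξ‖ ^ m := by
    intro j m hm
    have h1 := ((hcomp j).sum_rotations_isBigO (hcomp0 j) hζ (by simp)).trans_isLittleO
      ((isLittleO_pow_pow hm).comp_tendsto tendsto_norm_zero)
    refine (((Complex.reCLM.isBigO_comp _ _).trans_isLittleO h1).const_mul_left 2).congr_left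
      fun ξ => ?_
    simp [Finset.mul_sum]
  have hsq : (fun ξ => h ξ ^ 2) =o[𝓝 0] fun ξ => ‖ξ‖ ^ 4 := by
    refine isLittleO_of_sum_rotations (fun _ => sq_nonneg _) (n := 5) (ζ := ζ) (by simp) ?_
    refine ((sum_rotations_isLittleO (n := 5) hζ1 hgo).sub (hsum 2 4 (by simp))).congr_left
      fun ξ => ?_
    simp [Finset.sum_add_distrib]
  have hho : h =o[𝓝 0] fun ξ => ‖ξ‖ ^ 2 := by
    refine IsLittleO.of_pow (n := 2) ?_ (by simp)
    simpa [Pi.pow_def, ← pow_mul] using hsq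
  have hnsq : (fun ξ => Complex.normSq (φ ξ 0)) =o[𝓝 0] fun ξ => ‖ξ‖ ^ 2 := by
    refine isLittleO_of_sum_rotations (fun _ => Complex.normSq_nonneg _) (n := 5) (ζ := ζ)
      (by simp) ?_
    refine ((sum_rotations_isLittleO (n := 5) hζ1 hho).sub (hsum 1 2 (by simp))).congr_left
      fun ξ => ?_
    simp [hh, Finset.sum_add_distrib]
  have hpow : ∀ m, 1 < m → (fun ξ : ℂ => ‖ξ‖ ^ m) =o[𝓝 0] fun ξ => ‖ξ‖ := fun m hm => by
    simpa [Function.comp_def] using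
      (isLittleO_pow_pow (𝕜 := ℝ) hm).comp_tendsto (tendsto_norm_zero (E := ℂ))
  have hd0 : deriv (fun ξ => φ ξ 0) 0 = 0 := by
    refine deriv_eq_zero_of_re_isLittleO (hcomp 0).differentiableAt (hcomp0 0) ?_
    refine IsLittleO.of_pow (n := 2) ?_ (by simp)
    refine IsBigO.trans_isLittleO (IsBigO.of_norm_le fun ξ => ?_) hnsq
    simp [Complex.normSq_apply, sq, mul_self_nonneg]
  have hd1 : deriv (fun ξ => φ ξ 1) 0 = 0 := by
    refine deriv_eq_zero_of_re_isLittleO (hcomp 1).differentiableAt (hcomp0 1) ?_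
    refine (((hho.sub hnsq).trans (hpow 2 (by simp))).const_mul_left (1 / 2)).congr_left
      fun ξ => ?_
    simp only [hh]
    ring
  have hd2 : deriv (fun ξ => φ ξ 2) 0 = 0 := by
    refine deriv_eq_zero_of_re_isLittleO (hcomp 2).differentiableAt (hcomp0 2) ?_
    refine (((hgo.sub hsq).trans (hpow 4 (by simp))).const_mul_left (1 / 2)).congr_left
      fun ξ => ?_
    ring
  refine hφ' ?_
  ext j
  have hj := hasFDerivAt_pi'.1 hφ.differentiableAt.hasFDerivAt j
  have : fderiv ℂ φ 0 1 j = deriv (fun ξ => φ ξ j) 0 := by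
    rw [← fderiv_apply_one_eq_deriv, hj.fderiv]
    rfl
  rw [this]
  fin_cases j
  exacts [hd0, hd1, hd2]

lemma analyticAt_bloomCurve : AnalyticAt ℂ (fun ξ : ℂ => (![ξ, 0, 0] : Cn 3)) 0 := by
  refine analyticAt_pi_iff.2 fun j => ?_
  fin_cases j
  exacts [analyticAt_id, analyticAt_const, analyticAt_const]

lemma fderiv_bloomCurve_ne_zero : fderiv ℂ (fun ξ : ℂ => (![ξ, 0, 0] : Cn 3)) 0 ≠ 0 := by
  intro h
  have hj := hasFDerivAt_pi'.1 analyticAt_bloomCurve.differentiableAt.hasFDerivAt 0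
  rw [h] at hj
  simpa using DFunLike.congr_fun (hj.unique (hasFDerivAt_id (𝕜 := ℂ) (0 : ℂ))) 1

lemma ordAt_bloomCurve : ordAt (fun ξ : ℂ => bloomRho ![ξ, 0, 0]) = 4 := by
  refine le_antisymm (ordAt_bloom_le analyticAt_bloomCurve
    (by ext j; fin_cases j <;> rfl) fderiv_bloomCurve_ne_zero) ?_
  have hform : (fun ξ : ℂ => bloomRho ![ξ, 0, 0]) = fun ξ => (ξ.re * ξ.re + ξ.im * ξ.im) ^ 2 := by
    ext ξ
    simp [bloomRho, Complex.normSq_apply]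
  refine le_sInf ?_
  rintro m ⟨k, rfl, hk⟩
  by_contra! hlt
  have hk4 : k < 4 := by exact_mod_cast hlt
  refine hk ?_
  rw [hform]
  have hsmooth : ContDiff ℝ k fun ξ : ℂ => (ξ.re * ξ.re + ξ.im * ξ.im) ^ 2 := by
    have h1 : ContDiff ℝ k Complex.re := Complex.reCLM.contDiff
    have h2 : ContDiff ℝ k Complex.im := Complex.imCLM.contDiff
    fun_prop
  have hscale := congrFun (iteratedFDeriv_comp_const_smul (2 : ℝ) hsmooth) 0
  have hhom : (fun ξ : ℂ => (((2 : ℝ) • ξ).re * ((2 : ℝ) • ξ).re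
      + ((2 : ℝ) • ξ).im * ((2 : ℝ) • ξ).im) ^ 2) =
      fun ξ : ℂ => (2 : ℝ) ^ 4 • (ξ.re * ξ.re + ξ.im * ξ.im) ^ 2 := by
    ext ξ
    simp
    ring
  rw [hhom, iteratedFDeriv_const_smul_apply' hsmooth.contDiffAt, smul_zero] at hscale
  have hne : (2 : ℝ) ^ 4 - 2 ^ k ≠ 0 := by
    interval_cases k <;> norm_num
  refine (smul_eq_zero.1 ?_).resolve_left hne
  rw [sub_smul, hscale, sub_self]

/-- Bloom's example. For `M = {ρ = 0} ⊂ ℂ³` with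
`ρ = 2Re(w) + (z₂ + z̄₂ + |z₁|²)²` and `p = 0`:
(i) every nonsingular holomorphic curve through `0` has order of contact at most `4` with
`M` at `0`, the curve `ξ ↦ (ξ,0,0)` has order of contact exactly `4`, and `a^{(1)}(M,0) = 4`;
(ii) `L = ∂/∂z₁ − z̄₁ ∂/∂z₂` is a nowhere-vanishing CR vector field along `M` with
`t_L(M,0) = ∞` and `c_L(M,0) = ∞`, and `t^{(1)}(M,0) = c^{(1)}(M,0) = ∞`. -/
theorem bloom_example :
    (∀ φ : ℂ → Cn 3, AnalyticAt ℂ φ 0 → φ 0 = 0 → fderiv ℂ φ 0 ≠ 0 →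
      ordAt (fun ξ => bloomRho (φ ξ)) ≤ 4) ∧
    ordAt (fun ξ : ℂ => bloomRho ![ξ, 0, 0]) = 4 ∧
    aOne bloomRho 0 = 4 ∧
    (∀ z : Cn 3, ∑ j, bloomL j z * wz j (cx bloomRho) z = 0) ∧
    (∀ z : Cn 3, (fun j => bloomL j z) ≠ 0) ∧
    tType bloomRho bloomL 0 = ⊤ ∧
    cType bloomRho bloomL 0 = ⊤ ∧
    tOne bloomRho {z | bloomRho z = 0} 0 = ⊤ ∧
    cOne bloomRho {z | bloomRho z = 0} 0 = ⊤ := by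
  refine ⟨fun φ => ordAt_bloom_le, ordAt_bloomCurve, le_antisymm (sSup_le ?_) (le_sSup ?_),
    bloomL_tangent, bloomL_ne_zero, tType_bloom, cType_bloom, top_unique (le_sSup ?_),
    top_unique (le_sSup ?_)⟩
  · rintro t ⟨φ, hφ, h0, hφ', rfl⟩
    exact ordAt_bloom_le hφ h0 hφ'
  · exact ⟨_, analyticAt_bloomCurve, by ext j; fin_cases j <;> rfl, fderiv_bloomCurve_ne_zero,
      ordAt_bloomCurve.symm⟩
  · exact ⟨bloomL, contDiff_bloomL, .of_forall fun x _ => bloomL_tangent x,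
      .of_forall bloomL_ne_zero, tType_bloom.symm⟩
  · exact ⟨bloomL, contDiff_bloomL, .of_forall fun x _ => bloomL_tangent x,
      .of_forall bloomL_ne_zero, cType_bloom.symm⟩
end
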